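/- For a language L of 2-wave words over Σ, the following are equivalent: (i) L is definable in EMSO(Σ,<,M1,M2); (ii) L is definable in MSO(Σ,<,M1,M2); (iii) L is regular, i.e. L = L_WW2(A) for some 2NWA A. -/

import Mathlib

/-- A matching relation of length `n`, on positions `1, …, n`. -/
structure Matching (n : ℕ) where
  rel : ℕ → ℕ → Prop
  ordered : ∀ i j, rel i j → 1 ≤ i ∧ i < j ∧ j ≤ n
  unique : ∀ i j k l, rel i j → rel k l →
    (i = k ∨ i = l ∨ j = k ∨ j = l) → i = k ∧ j = l
  noncrossing : ∀ i j k l, rel i j → rel k l → i < k → k < j → l < j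

/-- A 2-nested word: a word together with two matchings of its length. -/
structure TwoNW (α : Type) where
  word : List α
  M1 : Matching word.length
  M2 : Matching word.length

def Matching.IsCall {n : ℕ} (M : Matching n) (i : ℕ) : Prop := ∃ j, M.rel i j
def Matching.IsRet {n : ℕ} (M : Matching n) (i : ℕ) : Prop := ∃ j, M.rel j i
def Matching.IsInt {n : ℕ} (M : Matching n) (i : ℕ) : Prop := ¬ M.IsCall i ∧ ¬ M.IsRet i

/-- `(i1,i2,i3,i4)` is a 2-wave of the pair of matchings `(M1, M2)`. -/
def IsTwoWaveQuad {n : ℕ} (M1 M2 : Matching n) (i1 i2 i3 i4 : ℕ) : Prop :=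
  i1 < i2 ∧ i2 < i3 ∧ i3 < i4 ∧
  M1.rel i1 i2 ∧ M1.rel i3 i4 ∧ M2.rel i2 i3 ∧ M2.rel i1 i4

/-- A 2-wave structure: every arch of `M1 ∪ M2` is an arch of some 2-wave. -/
def IsWaveStructure {n : ℕ} (M1 M2 : Matching n) : Prop :=
  (∀ i j, M1.rel i j → ∃ i1 i2 i3 i4, IsTwoWaveQuad M1 M2 i1 i2 i3 i4 ∧
      ((i = i1 ∧ j = i2) ∨ (i = i3 ∧ j = i4))) ∧
  (∀ i j, M2.rel i j → ∃ i1 i2 i3 i4, IsTwoWaveQuad M1 M2 i1 i2 i3 i4 ∧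
      ((i = i2 ∧ j = i3) ∨ (i = i1 ∧ j = i4)))

/-- A 2-wave word. -/
def TwoNW.IsWaveWord {α : Type} (ω : TwoNW α) : Prop := IsWaveStructure ω.M1 ω.M2

/-- A 2-nested word automaton (2NWA); each transition table is presented as a
set of (input, output) pairs. -/
structure TwoNWA (α Q P : Type) where
  init : Set Q
  final : Set Q
  Δcc : Set ((Q × α) × (P × P × Q))
  Δrc : Set ((Q × P × α) × (P × Q))
  Δcr : Set ((Q × P × α) × (P × Q))
  Δrr : Set ((Q × P × P × α) × Q)
  Δci : Set ((Q × α) × (P × Q))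
  Δic : Set ((Q × α) × (P × Q))
  Δri : Set ((Q × P × α) × Q)
  Δir : Set ((Q × P × α) × Q)
  Δii : Set ((Q × α) × Q)

/-- The local run condition at position `i` (with `1 ≤ i ≤ |w|`): `ℓ` is the
sequence of linear states, and `h1 i` (resp. `h2 i`) is the hierarchical state
labelling the `M1`- (resp. `M2`-) arch whose call position is `i`. -/
def TwoNWA.RunAt {α Q P : Type} (A : TwoNWA α Q P) (ω : TwoNW α)
    (ℓ : ℕ → Q) (h1 h2 : ℕ → P) (i : ℕ) : Prop :=
  ∃ a, ω.word[i - 1]? = some a ∧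
    ((ω.M1.IsCall i ∧ ω.M2.IsCall i ∧ ((ℓ (i-1), a), (h1 i, h2 i, ℓ i)) ∈ A.Δcc)
   ∨ (∃ j, ω.M1.rel j i ∧ ω.M2.IsCall i ∧ ((ℓ (i-1), h1 j, a), (h2 i, ℓ i)) ∈ A.Δrc)
   ∨ (ω.M1.IsCall i ∧ (∃ j, ω.M2.rel j i ∧ ((ℓ (i-1), h2 j, a), (h1 i, ℓ i)) ∈ A.Δcr))
   ∨ (∃ j k, ω.M1.rel j i ∧ ω.M2.rel k i ∧ ((ℓ (i-1), h1 j, h2 k, a), ℓ i) ∈ A.Δrr)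
   ∨ (ω.M1.IsCall i ∧ ω.M2.IsInt i ∧ ((ℓ (i-1), a), (h1 i, ℓ i)) ∈ A.Δci)
   ∨ (ω.M1.IsInt i ∧ ω.M2.IsCall i ∧ ((ℓ (i-1), a), (h2 i, ℓ i)) ∈ A.Δic)
   ∨ (∃ j, ω.M1.rel j i ∧ ω.M2.IsInt i ∧ ((ℓ (i-1), h1 j, a), ℓ i) ∈ A.Δri)
   ∨ (ω.M1.IsInt i ∧ (∃ j, ω.M2.rel j i ∧ ((ℓ (i-1), h2 j, a), ℓ i) ∈ A.Δir))
   ∨ (ω.M1.IsInt i ∧ ω.M2.IsInt i ∧ ((ℓ (i-1), a), ℓ i) ∈ A.Δii))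

def TwoNWA.IsRun {α Q P : Type} (A : TwoNWA α Q P) (ω : TwoNW α)
    (ℓ : ℕ → Q) (h1 h2 : ℕ → P) : Prop :=
  ∀ i, 1 ≤ i → i ≤ ω.word.length → A.RunAt ω ℓ h1 h2 i

def TwoNWA.Accepts {α Q P : Type} (A : TwoNWA α Q P) (ω : TwoNW α) : Prop :=
  ∃ ℓ h1 h2, A.IsRun ω ℓ h1 h2 ∧ ℓ 0 ∈ A.init ∧ ℓ ω.word.length ∈ A.final

/-- The language of 2-nested words accepted by `A`. -/
def TwoNWA.lang {α Q P : Type} (A : TwoNWA α Q P) : Set (TwoNW α) :=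
  { ω | A.Accepts ω }

/-- The language of 2-wave words accepted by `A`. -/
def TwoNWA.langWW {α Q P : Type} (A : TwoNWA α Q P) : Set (TwoNW α) :=
  { ω | A.Accepts ω ∧ ω.IsWaveWord }

/-- There is a run of `A` on `ω` from linear state `q` to linear state `q'`. -/
def TwoNWA.Exec {α Q P : Type} (A : TwoNWA α Q P) (ω : TwoNW α) (q q' : Q) : Prop :=
  ∃ ℓ h1 h2, A.IsRun ω ℓ h1 h2 ∧ ℓ 0 = q ∧ ℓ ω.word.length = q'

/-- Deterministic 2NWA: a single initial state, and each transition table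
induces a function from inputs to outputs. -/
def TwoNWA.Deterministic {α Q P : Type} (A : TwoNWA α Q P) : Prop :=
  (∃ q0, A.init = {q0}) ∧
  (∀ x y y', (x, y) ∈ A.Δcc → (x, y') ∈ A.Δcc → y = y') ∧
  (∀ x y y', (x, y) ∈ A.Δrc → (x, y') ∈ A.Δrc → y = y') ∧
  (∀ x y y', (x, y) ∈ A.Δcr → (x, y') ∈ A.Δcr → y = y') ∧
  (∀ x y y', (x, y) ∈ A.Δrr → (x, y') ∈ A.Δrr → y = y') ∧
  (∀ x y y', (x, y) ∈ A.Δci → (x, y') ∈ A.Δci → y = y') ∧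
  (∀ x y y', (x, y) ∈ A.Δic → (x, y') ∈ A.Δic → y = y') ∧
  (∀ x y y', (x, y) ∈ A.Δri → (x, y') ∈ A.Δri → y = y') ∧
  (∀ x y y', (x, y) ∈ A.Δir → (x, y') ∈ A.Δir → y = y') ∧
  (∀ x y y', (x, y) ∈ A.Δii → (x, y') ∈ A.Δii → y = y')

/-- Complete 2NWA: each transition table provides an output for every input. -/
def TwoNWA.Complete {α Q P : Type} (A : TwoNWA α Q P) : Prop :=
  (∀ x, ∃ y, (x, y) ∈ A.Δcc) ∧ (∀ x, ∃ y, (x, y) ∈ A.Δrc) ∧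
  (∀ x, ∃ y, (x, y) ∈ A.Δcr) ∧ (∀ x, ∃ y, (x, y) ∈ A.Δrr) ∧
  (∀ x, ∃ y, (x, y) ∈ A.Δci) ∧ (∀ x, ∃ y, (x, y) ∈ A.Δic) ∧
  (∀ x, ∃ y, (x, y) ∈ A.Δri) ∧ (∀ x, ∃ y, (x, y) ∈ A.Δir) ∧
  (∀ x, ∃ y, (x, y) ∈ A.Δii)

/-- Weakly-hierarchical post form: hierarchical states are the linear states,
and every hierarchical output of a transition equals its target linear state. -/
def TwoNWA.PostForm {α Q : Type} (A : TwoNWA α Q Q) : Prop :=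
  (∀ t ∈ A.Δcc, t.2.1 = t.2.2.2 ∧ t.2.2.1 = t.2.2.2) ∧
  (∀ t ∈ A.Δrc, t.2.1 = t.2.2) ∧
  (∀ t ∈ A.Δcr, t.2.1 = t.2.2) ∧
  (∀ t ∈ A.Δci, t.2.1 = t.2.2) ∧
  (∀ t ∈ A.Δic, t.2.1 = t.2.2)

/-- Nice 2NWA: in every non-internal transition all hierarchical states
involved are equal. -/
def TwoNWA.Nice {α Q P : Type} (A : TwoNWA α Q P) : Prop :=
  (∀ t ∈ A.Δcc, t.2.1 = t.2.2.1) ∧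
  (∀ t ∈ A.Δrc, t.1.2.1 = t.2.1) ∧
  (∀ t ∈ A.Δcr, t.1.2.1 = t.2.1) ∧
  (∀ t ∈ A.Δrr, t.1.2.1 = t.1.2.2.1)

/-- A regular language of 2-nested words. -/
def RegularTwoNWL {α : Type} (L : Set (TwoNW α)) : Prop :=
  ∃ (Q P : Type) (_ : Finite Q) (_ : Finite P) (A : TwoNWA α Q P), A.lang = L

/-- Formulas of MSO(Σ,<,M1,M2); first-order and second-order variables are
both indexed by natural numbers. -/
inductive MSO (α : Type) : Type
  | qa : α → ℕ → MSO α          -- Q_a(x)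
  | lt : ℕ → ℕ → MSO α          -- x < y
  | mem : ℕ → ℕ → MSO α         -- X(x) : (set variable, first-order variable)
  | m1 : ℕ → ℕ → MSO α          -- M1(x,y)
  | m2 : ℕ → ℕ → MSO α          -- M2(x,y)
  | not : MSO α → MSO α
  | and : MSO α → MSO α → MSO α
  | exFO : ℕ → MSO α → MSO α
  | exSO : ℕ → MSO α → MSO α

/-- Satisfaction over a 2-nested word `ω`, under valuations `ν1` of first-order
variables (positions in `[1,|w|]`) and `ν2` of set variables (sets of positions). -/
def MSO.Sat {α : Type} (ω : TwoNW α) : (ℕ → ℕ) → (ℕ → Set ℕ) → MSO α → Prop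
  | ν1, _, .qa a x => ω.word[ν1 x - 1]? = some a
  | ν1, _, .lt x y => ν1 x < ν1 y
  | ν1, ν2, .mem X x => ν1 x ∈ ν2 X
  | ν1, _, .m1 x y => ω.M1.rel (ν1 x) (ν1 y)
  | ν1, _, .m2 x y => ω.M2.rel (ν1 x) (ν1 y)
  | ν1, ν2, .not φ => ¬ MSO.Sat ω ν1 ν2 φ
  | ν1, ν2, .and φ ψ => MSO.Sat ω ν1 ν2 φ ∧ MSO.Sat ω ν1 ν2 ψ
  | ν1, ν2, .exFO x φ => ∃ i, 1 ≤ i ∧ i ≤ ω.word.length ∧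
      MSO.Sat ω (Function.update ν1 x i) ν2 φ
  | ν1, ν2, .exSO X φ => ∃ I : Set ℕ, I ⊆ Set.Icc 1 ω.word.length ∧
      MSO.Sat ω ν1 (Function.update ν2 X I) φ

def MSO.freeFO {α : Type} : MSO α → Set ℕ
  | .qa _ x => {x}
  | .lt x y => {x, y}
  | .mem _ x => {x}
  | .m1 x y => {x, y}
  | .m2 x y => {x, y}
  | .not φ => φ.freeFO
  | .and φ ψ => φ.freeFO ∪ ψ.freeFO
  | .exFO x φ => φ.freeFO \ {x}
  | .exSO _ φ => φ.freeFO

def MSO.freeSO {α : Type} : MSO α → Set ℕ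
  | .qa _ _ => ∅
  | .lt _ _ => ∅
  | .mem X _ => {X}
  | .m1 _ _ => ∅
  | .m2 _ _ => ∅
  | .not φ => φ.freeSO
  | .and φ ψ => φ.freeSO ∪ ψ.freeSO
  | .exFO _ φ => φ.freeSO
  | .exSO X φ => φ.freeSO \ {X}

/-- A closed formula (a sentence). -/
def MSO.Closed {α : Type} (φ : MSO α) : Prop := φ.freeFO = ∅ ∧ φ.freeSO = ∅

/-- First-order formulas: no second-order quantifier. -/
def MSO.IsFO {α : Type} : MSO α → Prop
  | .not φ => φ.IsFO
  | .and φ ψ => φ.IsFO ∧ ψ.IsFO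
  | .exFO _ φ => φ.IsFO
  | .exSO _ _ => False
  | _ => True

/-- Existential MSO formulas: `∃X1 … ∃Xn φ` with `φ` first-order. -/
inductive MSO.IsEMSO {α : Type} : MSO α → Prop
  | fo {φ : MSO α} : φ.IsFO → φ.IsEMSO
  | ex {X : ℕ} {φ : MSO α} : φ.IsEMSO → (MSO.exSO X φ).IsEMSO

/-- `ω ⊨ φ` (for sentences: satisfaction under every valuation). -/
def MSO.Models {α : Type} (ω : TwoNW α) (φ : MSO α) : Prop :=
  ∀ ν1 ν2, MSO.Sat ω ν1 ν2 φ

/-- The language of 2-wave words defined by a sentence `φ`: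
`L_WW2(φ) = L(φ) ∩ WW2(Σ)`. -/
def MSOLangWW {α : Type} (φ : MSO α) : Set (TwoNW α) :=
  { ω | ω.IsWaveWord ∧ MSO.Models ω φ }
/-! ### Tree decompositions of 2-wave structures and finite algebras -/

/-- Terms describing how a 2-wave structure is assembled. A term denotes either one factor of
the structure or (after `base`) two linked factors; natural numbers are positions. -/
inductive WTree : Type
  | nil : WTree
  | int : WTree → ℕ → WTree
  | base : WTree → WTree
  | node : WTree → ℕ → ℕ → ℕ → ℕ → WTree → WTree → WTree

/-- An algebra interpreting the term constructors of `WTree`, positions being replaced by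
their labels in `Λ`. -/
structure WaveAlg (Λ X : Type) where
  nil : X
  int : X → Λ → X
  base : X → X
  node : X → Λ → Λ → Λ → Λ → X → X → X

namespace WTree

def eval {Λ X : Type} (A : WaveAlg Λ X) (f : ℕ → Λ) : WTree → X
  | nil => A.nil
  | int t p => A.int (eval A f t) (f p)
  | base t => A.base (eval A f t)
  | node t i j k l u s =>
      A.node (eval A f t) (f i) (f j) (f k) (f l) (eval A f u) (eval A f s)

/-- The positions occurring in a term. -/
def pos : WTree → Set ℕ
  | nil => ∅
  | int t p => insert p t.pos
  | base t => t.pos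
  | node t i j k l u s => t.pos ∪ u.pos ∪ s.pos ∪ {i, j, k, l}

/-- No position occurs twice. -/
def Disj : WTree → Prop
  | nil => True
  | int t p => t.Disj ∧ p ∉ t.pos
  | base t => t.Disj
  | node t i j k l u s => t.Disj ∧ u.Disj ∧ s.Disj ∧
      (∀ p ∈ t.pos, p ∉ u.pos) ∧ (∀ p ∈ t.pos, p ∉ s.pos) ∧ (∀ p ∈ u.pos, p ∉ s.pos) ∧
      [i, j, k, l].Nodup ∧ ∀ p ∈ [i, j, k, l], p ∉ t.pos ∧ p ∉ u.pos ∧ p ∉ s.pos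

/-- The quadruples at the nodes of a term. -/
def quads : WTree → Set (ℕ × ℕ × ℕ × ℕ)
  | nil => ∅
  | int t _ => t.quads
  | base t => t.quads
  | node t i j k l u s => insert (i, j, k, l) (t.quads ∪ u.quads ∪ s.quads)

/-- The positions of internal letters of a term. -/
def ints : WTree → Set ℕ
  | nil => ∅
  | int t p => insert p t.ints
  | base t => t.ints
  | node t _ _ _ _ u s => t.ints ∪ u.ints ∪ s.ints

/-- The combination of segments at a `WTree.node`. -/
def nodeSegs {M : Type} [Mul M] (t : Bool × M × M) (i j k l : M) (u s : Bool × M × M) :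
    Bool × M × M :=
  match s.1, t.1 with
  | true, _ => (true, t.2.1 * i * u.2.1 * j * s.2.1, t.2.2 * s.2.2 * k * u.2.2 * l)
  | false, true =>
      (true, t.2.1, t.2.2 * i * u.2.1 * j * s.2.1 * s.2.2 * k * u.2.2 * l)
  | false, false =>
      (false, t.2.1 * i * u.2.1 * j * s.2.1 * k * u.2.2 * l, t.2.2 * s.2.2)

/-- The algebra multiplying the labels of each of the two factors in order of position; the
Boolean tells whether a second factor has been opened. -/
def monoidAlg {Λ M : Type} [Monoid M] (g : Λ → M) : WaveAlg Λ (Bool × M × M) where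
  nil := (false, 1, 1)
  int t a := if t.1 then (true, t.2.1, t.2.2 * g a) else (false, t.2.1 * g a, t.2.2)
  base t := (true, t.2.1, t.2.2)
  node t a b c d u s := nodeSegs t (g a) (g b) (g c) (g d) u s

/-- The two factors described by a term, as lists of positions. -/
def segs (t : WTree) : Bool × FreeMonoid ℕ × FreeMonoid ℕ :=
  t.eval (monoidAlg FreeMonoid.of) id

theorem eval_monoidAlg {Λ M : Type} [Monoid M] (g : Λ → M) (f : ℕ → Λ) (t : WTree) :
    t.eval (monoidAlg g) f = (t.segs.1, FreeMonoid.lift (g ∘ f) t.segs.2.1,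
      FreeMonoid.lift (g ∘ f) t.segs.2.2) := by
  induction t with
  | nil => simp [eval, segs, monoidAlg]
  | int t p ih =>
    simp only [eval, segs] at ih ⊢
    rw [ih]
    simp only [monoidAlg]
    split_ifs <;> simp
  | base t ih =>
    simp only [eval, segs] at ih ⊢
    rw [ih]
    simp [monoidAlg]
  | node t i j k l u s iht ihu ihs =>
    simp only [eval, segs] at iht ihu ihs ⊢
    rw [iht, ihu, ihs]
    generalize eval (monoidAlg FreeMonoid.of) id t = T
    generalize eval (monoidAlg FreeMonoid.of) id u = U
    generalize eval (monoidAlg FreeMonoid.of) id s = S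
    obtain ⟨_ | _, _, _⟩ := T <;> obtain ⟨_ | _, _, _⟩ := S <;> simp [monoidAlg, nodeSegs]

theorem mem_pos_iff (t : WTree) (p : ℕ) :
    p ∈ t.pos ↔ p ∈ t.segs.2.1.toList ++ t.segs.2.2.toList := by
  induction t with
  | nil => simp [pos, segs, eval, monoidAlg]
  | int t q ih =>
    simp only [segs, eval, pos, Set.mem_insert_iff, ih]
    generalize eval (monoidAlg FreeMonoid.of) id t = T
    obtain ⟨_ | _, _, _⟩ := T <;> simp [monoidAlg] <;> tauto
  | base t ih =>
    simp only [segs, eval, pos, ih]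
    simp [monoidAlg]
  | node t i j k l u s iht ihu ihs =>
    simp only [segs, eval, pos, Set.mem_union, Set.mem_insert_iff, Set.mem_singleton_iff,
      iht, ihu, ihs]
    generalize eval (monoidAlg FreeMonoid.of) id t = T
    generalize eval (monoidAlg FreeMonoid.of) id u = U
    generalize eval (monoidAlg FreeMonoid.of) id s = S
    obtain ⟨_ | _, _, _⟩ := T <;> obtain ⟨_ | _, _, _⟩ := S <;>
      simp [monoidAlg, nodeSegs] <;> grind

theorem disj_of_nodup (t : WTree) (h : (t.segs.2.1.toList ++ t.segs.2.2.toList).Nodup) :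
    t.Disj := by
  induction t with
  | nil => trivial
  | int t q ih =>
    simp only [Disj, mem_pos_iff]
    simp only [segs, eval] at h ih ⊢
    generalize eval (monoidAlg FreeMonoid.of) id t = T at *
    obtain ⟨_ | _, _, _⟩ := T <;>
      simp [monoidAlg, List.nodup_append, List.nodup_cons] at h ih ⊢ <;> grind
  | base t ih =>
    simp only [segs, eval] at h ih
    exact ih (by simpa [monoidAlg] using h)
  | node t i j k l u s iht ihu ihs =>
    simp only [Disj, mem_pos_iff]
    simp only [segs, eval] at h iht ihu ihs ⊢
    generalize eval (monoidAlg FreeMonoid.of) id t = T at *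
    generalize eval (monoidAlg FreeMonoid.of) id u = U at *
    generalize eval (monoidAlg FreeMonoid.of) id s = S at *
    obtain ⟨_ | _, _, _⟩ := T <;> obtain ⟨_ | _, _, _⟩ := S <;>
      simp [monoidAlg, nodeSegs, List.nodup_append, List.nodup_cons] at h iht ihu ihs ⊢ <;>
      grind

theorem mem_pos_cases (t : WTree) (p : ℕ) (h : p ∈ t.pos) : p ∈ t.ints ∨
    ∃ q ∈ t.quads, p = q.1 ∨ p = q.2.1 ∨ p = q.2.2.1 ∨ p = q.2.2.2 := by
  induction t with
  | nil => exact h.elim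
  | int t q ih =>
    simp only [pos, ints, quads, Set.mem_insert_iff] at h ⊢
    grind
  | base t ih => exact ih h
  | node t i j k l u s iht ihu ihs =>
    simp only [pos, ints, quads, Set.mem_insert_iff, Set.mem_union,
      Set.mem_singleton_iff] at h ⊢
    rcases h with ((h | h) | h) | h
    · grind
    · grind
    · grind
    · exact Or.inr ⟨(i, j, k, l), Or.inl rfl, h⟩

theorem eval_congr {Λ X : Type} (A : WaveAlg Λ X) {f g : ℕ → Λ} (t : WTree)
    (h : ∀ p ∈ t.pos, f p = g p) : t.eval A f = t.eval A g := by
  induction t with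
  | nil => rfl
  | int t p ih =>
    simp only [pos, Set.mem_insert_iff, forall_eq_or_imp] at h
    simp [eval, ih h.2, h.1]
  | base t ih => simp [eval, ih h]
  | node t i j k l u s iht ihu ihs =>
    simp only [pos, Set.mem_insert_iff, Set.mem_union, Set.mem_singleton_iff] at h
    simp only [eval]
    rw [iht (by grind), ihu (by grind), ihs (by grind), h i (by simp), h j (by simp),
      h k (by simp), h l (by simp)]

/-- The powerset algebra: evaluation collects the values of all relabellings along `r`. -/
def projAlg {Λ X : Type} (A : WaveAlg Λ X) (r : Λ → Λ → Prop) : WaveAlg Λ (Set X) where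
  nil := {A.nil}
  int S a := {y | ∃ x ∈ S, ∃ a', r a a' ∧ A.int x a' = y}
  base S := A.base '' S
  node S a b c d U V := {y | ∃ x ∈ S, ∃ u ∈ U, ∃ v ∈ V, ∃ a' b' c' d',
    r a a' ∧ r b b' ∧ r c c' ∧ r d d' ∧ A.node x a' b' c' d' u v = y}

theorem mem_eval_projAlg {Λ X : Type} (A : WaveAlg Λ X) (r : Λ → Λ → Prop) (f : ℕ → Λ)
    (t : WTree) (ht : t.Disj) (y : X) : y ∈ t.eval (projAlg A r) f ↔
      ∃ g : ℕ → Λ, (∀ p ∈ t.pos, r (f p) (g p)) ∧ t.eval A g = y := by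
  classical
  induction t generalizing y with
  | nil =>
    simp only [eval, projAlg, pos, Set.mem_singleton_iff, Set.mem_empty_iff_false,
      false_imp_iff, implies_true, true_and, exists_const_iff]
    exact ⟨fun h => ⟨⟨f⟩, h.symm⟩, fun h => h.2.symm⟩
  | int t p ih =>
    simp only [eval, projAlg, pos, Set.mem_insert_iff, forall_eq_or_imp, Set.mem_ofPred_eq]
    constructor
    · rintro ⟨x, hx, a, ha, rfl⟩
      obtain ⟨g, hg, rfl⟩ := (ih ht.1 x).1 hx
      have hne : ∀ q ∈ t.pos, q ≠ p := fun q hq h => ht.2 (h ▸ hq)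
      refine ⟨Function.update g p a, ⟨by simpa using ha, fun q hq => ?_⟩, ?_⟩
      · rw [Function.update_of_ne (hne q hq)]
        exact hg q hq
      · rw [Function.update_self, eval_congr A t fun q hq => Function.update_of_ne (hne q hq) _ _]
    · rintro ⟨g, ⟨hp, hg⟩, rfl⟩
      exact ⟨_, (ih ht.1 _).2 ⟨g, hg, rfl⟩, _, hp, rfl⟩
  | base t ih =>
    simp only [eval, projAlg, pos, Set.mem_image]
    constructor
    · rintro ⟨x, hx, rfl⟩
      obtain ⟨g, hg, rfl⟩ := (ih ht x).1 hx
      exact ⟨g, hg, rfl⟩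
    · rintro ⟨g, hg, rfl⟩
      exact ⟨_, (ih ht _).2 ⟨g, hg, rfl⟩, rfl⟩
  | node t i j k l u s iht ihu ihs =>
    obtain ⟨dt, du, ds, htu, hts, hus, hn, hd⟩ := ht
    simp only [eval, projAlg, pos, Set.mem_ofPred_eq]
    constructor
    · rintro ⟨x, hx, y, hy, z, hz, a, b, c, d, ha, hb, hc, hd', rfl⟩
      obtain ⟨g1, hg1, rfl⟩ := (iht dt x).1 hx
      obtain ⟨g2, hg2, rfl⟩ := (ihu du y).1 hy
      obtain ⟨g3, hg3, rfl⟩ := (ihs ds z).1 hz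
      let g : ℕ → Λ := fun p => if p ∈ t.pos then g1 p else if p ∈ u.pos then g2 p else
        if p ∈ s.pos then g3 p else if p = i then a else if p = j then b else
        if p = k then c else d
      have e1 : ∀ p ∈ t.pos, g p = g1 p := by grind
      have e2 : ∀ p ∈ u.pos, g p = g2 p := by grind
      have e3 : ∀ p ∈ s.pos, g p = g3 p := by grind
      simp only [List.nodup_cons, List.mem_cons, List.not_mem_nil, or_false] at hn hd
      have e4 : g i = a := by grind
      have e5 : g j = b := by grind
      have e6 : g k = c := by grind
      have e7 : g l = d := by grind
      refine ⟨g, ?_, ?_⟩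
      · simp only [Set.mem_union, Set.mem_insert_iff, Set.mem_singleton_iff]
        grind
      · rw [eval_congr A t e1, eval_congr A u e2, eval_congr A s e3, e4, e5, e6, e7]
    · rintro ⟨g, hg, rfl⟩
      simp only [Set.mem_union, Set.mem_insert_iff, Set.mem_singleton_iff] at hg
      exact ⟨_, (iht dt _).2 ⟨g, by grind, rfl⟩, _, (ihu du _).2 ⟨g, by grind, rfl⟩,
        _, (ihs ds _).2 ⟨g, by grind, rfl⟩, _, _, _, _, hg i (by simp), hg j (by simp),
        hg k (by simp), hg l (by simp), rfl⟩

end WTree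

/-! ### Recognizable properties of labelled terms -/

/-- A property of labelled terms is recognizable if it is decided by evaluation in a finite
algebra. -/
def WaveRecognizable {Λ : Type} (K : WTree → (ℕ → Λ) → Prop) : Prop :=
  ∃ (X : Type) (_ : Finite X) (A : WaveAlg Λ X) (F : Set X),
    ∀ (t : WTree) (f : ℕ → Λ), t.Disj → (t.eval A f ∈ F ↔ K t f)

namespace WaveRecognizable

variable {Λ : Type} {K K' : WTree → (ℕ → Λ) → Prop}

theorem congr_labels (h : WaveRecognizable K) {t : WTree} (ht : t.Disj) {f g : ℕ → Λ}
    (hfg : ∀ p ∈ t.pos, f p = g p) : K t f ↔ K t g := by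
  obtain ⟨X, _, A, F, hA⟩ := h
  rw [← hA t f ht, ← hA t g ht, WTree.eval_congr A t hfg]

theorem not (h : WaveRecognizable K) : WaveRecognizable fun t f => ¬ K t f := by
  obtain ⟨X, hX, A, F, hA⟩ := h
  exact ⟨X, hX, A, Fᶜ, fun t f ht => by rw [Set.mem_compl_iff, hA t f ht]⟩

theorem and (h : WaveRecognizable K) (h' : WaveRecognizable K') :
    WaveRecognizable fun t f => K t f ∧ K' t f := by
  obtain ⟨X, hX, A, F, hA⟩ := h
  obtain ⟨Y, hY, B, G, hB⟩ := h'
  let C : WaveAlg Λ (X × Y) :=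
    { nil := (A.nil, B.nil)
      int := fun t a => (A.int t.1 a, B.int t.2 a)
      base := fun t => (A.base t.1, B.base t.2)
      node := fun t a b c d u s =>
        (A.node t.1 a b c d u.1 s.1, B.node t.2 a b c d u.2 s.2) }
  have hC : ∀ (f : ℕ → Λ) (t : WTree), t.eval C f = (t.eval A f, t.eval B f) := by
    intro f t
    induction t with
    | nil => rfl
    | int t p ih => simp [WTree.eval, ih, C]
    | base t ih => simp [WTree.eval, ih, C]
    | node t i j k l u s iht ihu ihs => simp [WTree.eval, iht, ihu, ihs, C]
  refine ⟨X × Y, inferInstance, C, F ×ˢ G, fun t f ht => ?_⟩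
  rw [hC, Set.mem_prod, hA t f ht, hB t f ht]

theorem proj (h : WaveRecognizable K) (r : Λ → Λ → Prop) :
    WaveRecognizable fun t f => ∃ g, (∀ p ∈ t.pos, r (f p) (g p)) ∧ K t g := by
  obtain ⟨X, hX, A, F, hA⟩ := h
  refine ⟨Set X, inferInstance, WTree.projAlg A r, {S | (S ∩ F).Nonempty}, fun t f ht => ?_⟩
  constructor
  · rintro ⟨y, hy, hyF⟩
    obtain ⟨g, hg, rfl⟩ := (WTree.mem_eval_projAlg A r f t ht y).1 hy
    exact ⟨g, hg, (hA t g ht).1 hyF⟩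
  · rintro ⟨g, hg, hK⟩
    exact ⟨t.eval A g, (WTree.mem_eval_projAlg A r f t ht _).2 ⟨g, hg, rfl⟩, (hA t g ht).2 hK⟩

theorem exists_quad (r : Λ → Λ → Λ → Λ → Prop) : WaveRecognizable fun t f =>
    ∃ q ∈ t.quads, r (f q.1) (f q.2.1) (f q.2.2.1) (f q.2.2.2) := by
  let A : WaveAlg Λ Prop :=
    { nil := False
      int := fun t _ => t
      base := fun t => t
      node := fun t a b c d u s => r a b c d ∨ ((t ∨ u) ∨ s) }
  refine ⟨Prop, inferInstance, A, {p | p}, fun t f ht => ?_⟩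
  clear ht
  change t.eval A f ↔ _
  induction t with
  | nil => simp [WTree.eval, WTree.quads, A]
  | int t p ih => simpa [WTree.eval, WTree.quads, A] using ih
  | base t ih => simpa [WTree.eval, WTree.quads, A] using ih
  | node t i j k l u s iht ihu ihs =>
    simp only [WTree.eval, WTree.quads, A, Set.mem_insert_iff, Set.mem_union, or_and_right,
      exists_or, exists_eq_left] at iht ihu ihs ⊢
    rw [iht, ihu, ihs]

theorem exists_pos (p : Λ → Prop) : WaveRecognizable fun t f => ∃ i ∈ t.pos, p (f i) := by
  let A : WaveAlg Λ Prop :=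
    { nil := False
      int := fun t a => p a ∨ t
      base := fun t => t
      node := fun t a b c d u s => ((t ∨ u) ∨ s) ∨ p a ∨ p b ∨ p c ∨ p d }
  refine ⟨Prop, inferInstance, A, {p | p}, fun t f ht => ?_⟩
  clear ht
  change t.eval A f ↔ _
  induction t with
  | nil => simp [WTree.eval, WTree.pos, A]
  | int t i ih => simpa [WTree.eval, WTree.pos, A] using or_congr (Iff.refl (p (f i))) ih
  | base t ih => simpa [WTree.eval, WTree.pos, A] using ih
  | node t i j k l u s iht ihu ihs =>
    simp only [WTree.eval, WTree.pos, A, Set.mem_insert_iff, Set.mem_union, or_and_right,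
      Set.mem_singleton_iff, exists_or, exists_eq_left] at iht ihu ihs ⊢
    rw [iht, ihu, ihs]

open Classical in
/-- The step function of an automaton reading a word from right to left and looking for a
letter satisfying `p` to the left of a letter satisfying `q`. -/
noncomputable def orderStep (p q : Λ → Prop) (a : Λ) : Function.End (Fin 3) := fun s =>
  if s = 0 then (if q a then 1 else 0) else if s = 1 then (if p a then 2 else 1) else 2

theorem prod_orderStep (p q : Λ → Prop) (l : List Λ) :
    ((l.map (orderStep p q)).prod 0 = 0 ↔ ∀ b ∈ l, ¬ q b) ∧
    ((l.map (orderStep p q)).prod 0 ≠ 2 ↔ l.Pairwise fun a b => ¬ (p a ∧ q b)) := by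
  induction l with
  | nil => simp [Function.End.one_def]
  | cons a l ih =>
    obtain ⟨ih0, ih2⟩ := ih
    rw [List.map_cons, List.prod_cons, List.forall_mem_cons, List.pairwise_cons, ← ih0, ← ih2]
    rw [show (orderStep p q a * (l.map (orderStep p q)).prod) 0 =
      orderStep p q a ((l.map (orderStep p q)).prod 0) from rfl]
    have h2 : (∀ b ∈ l, ¬ (p a ∧ q b)) ↔
        (¬ p a ∨ (l.map (orderStep p q)).prod 0 = 0) := by
      rw [ih0]
      by_cases h : p a <;> simp [h]
    rw [h2]
    generalize (l.map (orderStep p q)).prod 0 = x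
    unfold orderStep
    fin_cases x <;> by_cases hp : p a <;> by_cases hq : q a <;> simp [hp, hq]

theorem exists_lt (p q : Λ → Prop) : WaveRecognizable fun t f =>
    ¬ (t.segs.2.1.toList.map f).Pairwise fun a b => ¬ (p a ∧ q b) := by
  refine ⟨Bool × Function.End (Fin 3) × Function.End (Fin 3),
    inferInstanceAs (Finite (Bool × (Fin 3 → Fin 3) × (Fin 3 → Fin 3))),
    WTree.monoidAlg (orderStep p q), {x | x.2.1 0 = 2}, fun t f _ => ?_⟩
  have h := (prod_orderStep p q (t.segs.2.1.toList.map f)).2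
  rw [List.map_map, ← FreeMonoid.lift_apply] at h
  rw [WTree.eval_monoidAlg, ← not_iff_not, not_not]
  exact h

end WaveRecognizable

theorem pairwise_map_range'_iff {Λ : Type} (f : ℕ → Λ) (R : Λ → Λ → Prop) (n : ℕ) :
    ((List.range' 1 n).map f).Pairwise R ↔
      ∀ i j, 1 ≤ i → j ≤ n → i < j → R (f i) (f j) := by
  rw [List.pairwise_map, List.pairwise_iff_getElem]
  simp only [List.getElem_range', List.length_range']
  constructor
  · intro h i j hi hj hij
    have := h (i - 1) (j - 1) (by omega) (by omega) (by omega)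
    rwa [show 1 + 1 * (i - 1) = i by omega, show 1 + 1 * (j - 1) = j by omega] at this
  · intro h i j hi hj hij
    exact h _ _ (by omega) (by omega) (by omega)

/-- The label of a position: its letter and the variables whose value is (or contains) it. -/
def TwoNW.label {α : Type} (ω : TwoNW α) (ν1 : ℕ → ℕ) (ν2 : ℕ → Set ℕ) (i : ℕ) :
    Option α × Set ℕ × Set ℕ :=
  (ω.word[i - 1]?, {x | ν1 x = i}, {X | i ∈ ν2 X})

/-- The term `t` describes the 2-nested word `ω`. -/
structure WTree.Describes {α : Type} (t : WTree) (ω : TwoNW α) : Prop where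
  disj : t.Disj
  segs_eq : t.segs.2.1.toList = List.range' 1 ω.word.length
  mem_pos : ∀ p, p ∈ t.pos ↔ 1 ≤ p ∧ p ≤ ω.word.length
  rel1 : ∀ i j, ω.M1.rel i j ↔ ∃ q ∈ t.quads, (i = q.1 ∧ j = q.2.1) ∨
    (i = q.2.2.1 ∧ j = q.2.2.2)
  rel2 : ∀ i j, ω.M2.rel i j ↔ ∃ q ∈ t.quads, (i = q.2.1 ∧ j = q.2.2.1) ∨
    (i = q.1 ∧ j = q.2.2.2)

theorem MSO.exists_waveRecognizable {α : Type} (φ : MSO α) :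
    ∃ K : WTree → (ℕ → Option α × Set ℕ × Set ℕ) → Prop, WaveRecognizable K ∧
      ∀ (ω : TwoNW α) (t : WTree), t.Describes ω → ∀ (ν1 : ℕ → ℕ) (ν2 : ℕ → Set ℕ),
        (∀ x ∈ φ.freeFO, 1 ≤ ν1 x ∧ ν1 x ≤ ω.word.length) →
        (K t (ω.label ν1 ν2) ↔ MSO.Sat ω ν1 ν2 φ) := by
  induction φ with
  | qa a x =>
    refine ⟨_, .exists_pos fun l => l.1 = some a ∧ x ∈ l.2.1, fun ω t ht ν1 ν2 hν => ?_⟩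
    have := hν x rfl
    simp only [TwoNW.label, MSO.Sat, ht.mem_pos, Set.mem_ofPred_eq]
    grind
  | mem X x =>
    refine ⟨_, .exists_pos fun l => X ∈ l.2.2 ∧ x ∈ l.2.1, fun ω t ht ν1 ν2 hν => ?_⟩
    have := hν x rfl
    simp only [TwoNW.label, MSO.Sat, ht.mem_pos, Set.mem_ofPred_eq]
    grind
  | lt x y =>
    refine ⟨_, .exists_lt (fun l => x ∈ l.2.1) (fun l => y ∈ l.2.1),
      fun ω t ht ν1 ν2 hν => ?_⟩
    have hx := hν x (Or.inl rfl)
    have hy := hν y (Or.inr rfl)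
    simp only [TwoNW.label, MSO.Sat, ht.segs_eq, pairwise_map_range'_iff, Set.mem_ofPred_eq]
    grind
  | m1 x y =>
    refine ⟨_, .exists_quad fun a b c d => (x ∈ a.2.1 ∧ y ∈ b.2.1) ∨ (x ∈ c.2.1 ∧ y ∈ d.2.1),
      fun ω t ht ν1 ν2 hν => ?_⟩
    simp only [TwoNW.label, MSO.Sat, ht.rel1, Set.mem_ofPred_eq]
  | m2 x y =>
    refine ⟨_, .exists_quad fun a b c d => (x ∈ b.2.1 ∧ y ∈ c.2.1) ∨ (x ∈ a.2.1 ∧ y ∈ d.2.1),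
      fun ω t ht ν1 ν2 hν => ?_⟩
    simp only [TwoNW.label, MSO.Sat, ht.rel2, Set.mem_ofPred_eq]
  | not φ ih =>
    obtain ⟨K, hK, h⟩ := ih
    exact ⟨_, hK.not, fun ω t ht ν1 ν2 hν => not_congr (h ω t ht ν1 ν2 hν)⟩
  | and φ ψ ihφ ihψ =>
    obtain ⟨K, hK, h⟩ := ihφ
    obtain ⟨K', hK', h'⟩ := ihψ
    exact ⟨_, hK.and hK', fun ω t ht ν1 ν2 hν => and_congr
      (h ω t ht ν1 ν2 fun x hx => hν x (Or.inl hx))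
      (h' ω t ht ν1 ν2 fun x hx => hν x (Or.inr hx))⟩
  | exFO x φ ih =>
    obtain ⟨K, hK, h⟩ := ih
    refine ⟨_, ((hK.and (.exists_pos fun l => x ∈ l.2.1)).and
      (WaveRecognizable.exists_lt (fun l => x ∈ l.2.1) (fun l => x ∈ l.2.1)).not).proj
        (fun l l' => l.1 = l'.1 ∧ (∀ y, y ≠ x → (y ∈ l.2.1 ↔ y ∈ l'.2.1)) ∧ l.2.2 = l'.2.2),
      fun ω t ht ν1 ν2 hν => ?_⟩
    simp only [not_not, MSO.Sat, ht.segs_eq, pairwise_map_range'_iff]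
    constructor
    · rintro ⟨g, hg, ⟨hKg, i, hi, hxi⟩, huniq⟩
      have hi' := (ht.mem_pos i).1 hi
      refine ⟨i, hi'.1, hi'.2, (h ω t ht _ _ ?_).1 ((hK.congr_labels ht.disj ?_).1 hKg)⟩
      · intro y hy
        by_cases hyx : y = x
        · subst hyx; simpa using hi'
        · simpa [Function.update_of_ne hyx] using hν y ⟨hy, hyx⟩
      · intro p hp
        obtain ⟨h1, h2, h3⟩ := hg p hp
        have hp' := (ht.mem_pos p).1 hp
        refine Prod.ext h1.symm (Prod.ext ?_ h3.symm)
        ext y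
        by_cases hyx : y = x
        · subst hyx
          simp only [TwoNW.label, Set.mem_ofPred_eq, Function.update_self]
          constructor
          · intro hy
            by_contra hne
            rcases Nat.lt_or_gt_of_ne hne with hlt | hlt
            · exact huniq _ _ hi'.1 hp'.2 hlt ⟨hxi, hy⟩
            · exact huniq _ _ hp'.1 hi'.2 hlt ⟨hy, hxi⟩
          · rintro rfl
            exact hxi
        · rw [← h2 y hyx]
          simp [TwoNW.label, Function.update_of_ne hyx]
    · rintro ⟨i, hi1, hi2, hs⟩
      refine ⟨ω.label (Function.update ν1 x i) ν2, fun p _ => ⟨rfl, fun y hy => ?_, rfl⟩,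
        ⟨(h ω t ht _ _ ?_).2 hs, i, (ht.mem_pos i).2 ⟨hi1, hi2⟩, ?_⟩, ?_⟩
      · simp [TwoNW.label, Function.update_of_ne hy]
      · intro y hy
        by_cases hyx : y = x
        · subst hyx; simpa using ⟨hi1, hi2⟩
        · simpa [Function.update_of_ne hyx] using hν y ⟨hy, hyx⟩
      · simp [TwoNW.label]
      · intro p q _ _ hpq
        simp only [TwoNW.label, Set.mem_ofPred_eq, Function.update_self]
        omega
  | exSO X φ ih =>
    obtain ⟨K, hK, h⟩ := ih
    refine ⟨_, hK.proj (fun l l' => l.1 = l'.1 ∧ l.2.1 = l'.2.1 ∧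
      ∀ Y, Y ≠ X → (Y ∈ l.2.2 ↔ Y ∈ l'.2.2)), fun ω t ht ν1 ν2 hν => ?_⟩
    simp only [MSO.Sat]
    constructor
    · rintro ⟨g, hg, hKg⟩
      refine ⟨{i | i ∈ t.pos ∧ X ∈ (g i).2.2}, fun i hi => (ht.mem_pos i).1 hi.1,
        (h ω t ht _ _ hν).1 ((hK.congr_labels ht.disj fun p hp => ?_).1 hKg)⟩
      obtain ⟨h1, h2, h3⟩ := hg p hp
      refine Prod.ext h1.symm (Prod.ext h2.symm ?_)
      ext Y
      by_cases hYX : Y = X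
      · subst hYX
        simp [TwoNW.label, hp]
      · rw [← h3 Y hYX]
        simp [TwoNW.label, Function.update_of_ne hYX]
    · rintro ⟨I, hI, hs⟩
      refine ⟨ω.label ν1 (Function.update ν2 X I), fun p _ => ⟨rfl, rfl, fun Y hY => ?_⟩,
        (h ω t ht _ _ hν).2 hs⟩
      simp [TwoNW.label, Function.update_of_ne hY]

/-! ### The term of a 2-wave structure -/

namespace Matching

variable {n : ℕ} (M : Matching n)

/-- `s` is the call of the innermost arch of `M` open after position `p`, or `0`. -/
def IsTop (s p : ℕ) : Prop :=
  s ≤ p ∧ (s = 0 ∨ ∃ e, p < e ∧ M.rel s e) ∧ ∀ c e, M.rel c e → s < c → c ≤ p → e ≤ p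

variable {M} {s s' j p e : ℕ}

theorem IsTop.unique (h : M.IsTop s p) (h' : M.IsTop s' p) : s = s' := by
  obtain ⟨h1, h2, h3⟩ := h
  obtain ⟨h1', h2', h3'⟩ := h'
  grind

theorem IsTop.call_le (h : M.IsTop s p) (hr : M.rel j e) (hj : j ≤ p) (he : p < e) : j ≤ s := by
  by_contra hs
  have := h.2.2 j e hr (by omega) hj
  omega

theorem isTop_call (h : M.rel p e) : M.IsTop p p := by
  have := M.ordered p e h
  exact ⟨le_rfl, Or.inr ⟨e, this.2.1, h⟩, fun c e hc h1 h2 => by omega⟩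

theorem IsTop.ret (h : M.rel j p) (hs : M.IsTop s (j - 1)) : M.IsTop s p := by
  obtain ⟨h1, h2, h3⟩ := hs
  have hjp := M.ordered j p h
  refine ⟨by omega, ?_, fun c e hc hsc hcp => ?_⟩
  · rcases h2 with h2 | ⟨e, he, hse⟩
    · exact Or.inl h2
    · have h4 := M.ordered s e hse
      have h5 : e ≠ j := fun h' => by
        have := M.unique s e j p hse h (by omega)
        omega
      exact Or.inr ⟨e, M.noncrossing s e j p hse h (by omega) (by omega), hse⟩
  · have h4 := M.ordered c e hc
    rcases Nat.lt_trichotomy c j with h5 | h5 | h5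
    · have := h3 c e hc hsc (by omega)
      omega
    · have := M.unique c e j p hc h (by omega)
      omega
    · rcases Nat.lt_or_ge c p with h6 | h6
      · have := M.noncrossing j p c e h hc h5 h6
        omega
      · have := M.unique c e j p hc h (by omega)
        omega

theorem isTop_before_ret (h : M.rel j p) : M.IsTop j (p - 1) := by
  have hjp := M.ordered j p h
  refine ⟨by omega, Or.inr ⟨p, by omega, h⟩, fun c e hc h1 h2 => ?_⟩
  have := M.noncrossing j p c e h hc h1 (by omega)
  omega

theorem IsTop.int (h : M.IsInt p) (hp : 1 ≤ p) (hs : M.IsTop s (p - 1)) : M.IsTop s p := by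
  obtain ⟨h1, h2, h3⟩ := hs
  refine ⟨by omega, ?_, fun c e hc hsc hcp => ?_⟩
  · rcases h2 with h2 | ⟨e, he, hse⟩
    · exact Or.inl h2
    · have : e ≠ p := fun h' => h.2 ⟨s, h' ▸ hse⟩
      exact Or.inr ⟨e, by omega, hse⟩
  · have : c ≠ p := fun h' => h.1 ⟨e, h' ▸ hc⟩
    have := h3 c e hc hsc (by omega)
    omega

theorem exists_isTop (M : Matching n) (p : ℕ) : ∃ s, M.IsTop s p := by
  induction p using Nat.strong_induction_on with
  | _ p ih =>
    rcases Nat.eq_zero_or_pos p with rfl | hp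
    · exact ⟨0, le_rfl, Or.inl rfl, fun c e _ h1 h2 => by omega⟩
    · by_cases hc : M.IsCall p
      · obtain ⟨e, he⟩ := hc
        exact ⟨p, isTop_call he⟩
      · by_cases hr : M.IsRet p
        · obtain ⟨j, hj⟩ := hr
          have := M.ordered j p hj
          obtain ⟨s, hs⟩ := ih (j - 1) (by omega)
          exact ⟨s, hs.ret hj⟩
        · obtain ⟨s, hs⟩ := ih (p - 1) (by omega)
          exact ⟨s, hs.int ⟨hc, hr⟩ hp⟩

theorem IsTop.eq_zero (h : M.IsTop s n) : s = 0 := by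
  obtain ⟨-, h | ⟨e, he, h⟩, -⟩ := h
  · exact h
  · have := M.ordered s e h
    omega

end Matching

namespace IsTwoWaveQuad

variable {n : ℕ} {M1 M2 : Matching n} {a b c d a' b' c' d' : ℕ}

theorem one_le (h : IsTwoWaveQuad M1 M2 a b c d) : 1 ≤ a :=
  (M1.ordered a b h.2.2.2.1).1

theorem le (h : IsTwoWaveQuad M1 M2 a b c d) : d ≤ n :=
  (M1.ordered c d h.2.2.2.2.1).2.2

/-- Two 2-waves sharing a position are equal, and the position plays the same role in both. -/
theorem eq_of_mem (h : IsTwoWaveQuad M1 M2 a b c d) (h' : IsTwoWaveQuad M1 M2 a' b' c' d')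
    (p : ℕ) (hp : p = a ∨ p = b ∨ p = c ∨ p = d) (hp' : p = a' ∨ p = b' ∨ p = c' ∨ p = d') :
    a = a' ∧ b = b' ∧ c = c' ∧ d = d' := by
  obtain ⟨h1, h2, h3, r1, r2, r3, r4⟩ := h
  obtain ⟨h1', h2', h3', r1', r2', r3', r4'⟩ := h'
  have A := M1.unique _ _ _ _ r1 r1'
  have B := M1.unique _ _ _ _ r1 r2'
  have C := M1.unique _ _ _ _ r2 r1'
  have D := M1.unique _ _ _ _ r2 r2'
  have E := M2.unique _ _ _ _ r3 r3'
  have F := M2.unique _ _ _ _ r3 r4'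
  have G := M2.unique _ _ _ _ r4 r3'
  have H := M2.unique _ _ _ _ r4 r4'
  omega

end IsTwoWaveQuad

namespace IsWaveStructure

variable {n : ℕ} {M1 M2 : Matching n}

theorem position_cases (hw : IsWaveStructure M1 M2) (p : ℕ) :
    (M1.IsInt p ∧ M2.IsInt p) ∨
      ∃ a b c d, IsTwoWaveQuad M1 M2 a b c d ∧ (p = a ∨ p = b ∨ p = c ∨ p = d) := by
  by_cases h1 : M1.IsCall p
  · obtain ⟨j, hj⟩ := h1
    obtain ⟨a, b, c, d, h, h'⟩ := hw.1 p j hj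
    exact Or.inr ⟨a, b, c, d, h, by omega⟩
  by_cases h2 : M1.IsRet p
  · obtain ⟨j, hj⟩ := h2
    obtain ⟨a, b, c, d, h, h'⟩ := hw.1 j p hj
    exact Or.inr ⟨a, b, c, d, h, by omega⟩
  by_cases h3 : M2.IsCall p
  · obtain ⟨j, hj⟩ := h3
    obtain ⟨a, b, c, d, h, h'⟩ := hw.2 p j hj
    exact Or.inr ⟨a, b, c, d, h, by omega⟩
  by_cases h4 : M2.IsRet p
  · obtain ⟨j, hj⟩ := h4
    obtain ⟨a, b, c, d, h, h'⟩ := hw.2 j p hj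
    exact Or.inr ⟨a, b, c, d, h, by omega⟩
  exact Or.inl ⟨⟨h1, h2⟩, h3, h4⟩

/-- Strong induction on positions, following the roles of positions in 2-waves. -/
theorem position_induction (hw : IsWaveStructure M1 M2) {P : ℕ → Prop} (zero : P 0)
    (int : ∀ p, 1 ≤ p → M1.IsInt p → M2.IsInt p → P (p - 1) → P p)
    (one : ∀ a b c d, IsTwoWaveQuad M1 M2 a b c d → P a)
    (two : ∀ a b c d, IsTwoWaveQuad M1 M2 a b c d → P b)
    (three : ∀ a b c d, IsTwoWaveQuad M1 M2 a b c d → P (b - 1) → P c)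
    (four : ∀ a b c d, IsTwoWaveQuad M1 M2 a b c d → P (a - 1) → P (c - 1) → P (d - 1) → P d)
    (p : ℕ) : P p := by
  induction p using Nat.strong_induction_on with
  | _ p ih =>
    rcases Nat.eq_zero_or_pos p with rfl | hp
    · exact zero
    rcases hw.position_cases p with h | ⟨a, b, c, d, h, rfl | rfl | rfl | rfl⟩
    · exact int p hp h.1 h.2 (ih _ (by omega))
    · exact one _ _ _ _ h
    · exact two _ _ _ _ h
    · have := h.1
      have := h.2.1
      exact three _ _ _ _ h (ih _ (by omega))
    · have := h.1
      have := h.2.1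
      have := h.2.2.1
      exact four _ _ _ _ h (ih _ (by omega)) (ih _ (by omega)) (ih _ (by omega))

end IsWaveStructure

section WaveTree

variable {n : ℕ} (M1 M2 : Matching n)

open Classical in
/-- The term read off a 2-wave structure up to a given position. -/
noncomputable def waveTree : ℕ → WTree
  | 0 => .nil
  | p + 1 =>
    if h : ∃ q : ℕ × ℕ × ℕ, IsTwoWaveQuad M1 M2 q.1 q.2.1 q.2.2 (p + 1) then
      .node (waveTree (min (h.choose.1 - 1) p)) h.choose.1 h.choose.2.1 h.choose.2.2 (p + 1)
        (waveTree p) (waveTree (min (h.choose.2.2 - 1) p))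
    else if h : ∃ q : ℕ × ℕ × ℕ, IsTwoWaveQuad M1 M2 q.1 q.2.1 (p + 1) q.2.2 then
      .base (waveTree (min (h.choose.2.1 - 1) p))
    else if ∃ a b c d, IsTwoWaveQuad M1 M2 a b c d ∧ (p + 1 = a ∨ p + 1 = b) then .nil
    else .int (waveTree p) (p + 1)
  decreasing_by all_goals omega

variable {M1 M2} {a b c d p : ℕ}

theorem waveTree_four (h : IsTwoWaveQuad M1 M2 a b c d) : waveTree M1 M2 d =
    .node (waveTree M1 M2 (a - 1)) a b c d (waveTree M1 M2 (d - 1))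
      (waveTree M1 M2 (c - 1)) := by
  obtain ⟨p, rfl⟩ : ∃ p, d = p + 1 := ⟨d - 1, by have := h.2.2.1; omega⟩
  have hex : ∃ q : ℕ × ℕ × ℕ, IsTwoWaveQuad M1 M2 q.1 q.2.1 q.2.2 (p + 1) := ⟨(a, b, c), h⟩
  rw [waveTree, dif_pos hex]
  obtain ⟨h1, h2, h3, -⟩ := hex.choose_spec.eq_of_mem h (p + 1) (by omega) (by omega)
  rw [h1, h2, h3]
  have := h.1
  have := h.2.1
  have := h.2.2.1
  rw [min_eq_left (by omega), min_eq_left (by omega), Nat.add_sub_cancel]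

theorem waveTree_three (h : IsTwoWaveQuad M1 M2 a b c d) : waveTree M1 M2 c =
    .base (waveTree M1 M2 (b - 1)) := by
  have := h.1
  have := h.2.1
  have := h.2.2.1
  obtain ⟨p, rfl⟩ : ∃ p, c = p + 1 := ⟨c - 1, by omega⟩
  have hex : ∃ q : ℕ × ℕ × ℕ, IsTwoWaveQuad M1 M2 q.1 q.2.1 (p + 1) q.2.2 := ⟨(a, b, d), h⟩
  have hnex : ¬ ∃ q : ℕ × ℕ × ℕ, IsTwoWaveQuad M1 M2 q.1 q.2.1 q.2.2 (p + 1) := by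
    rintro ⟨q, hq⟩
    have := hq.eq_of_mem h (p + 1) (by omega) (by omega)
    omega
  rw [waveTree, dif_neg hnex, dif_pos hex]
  obtain ⟨-, h2, -⟩ := hex.choose_spec.eq_of_mem h (p + 1) (by omega) (by omega)
  rw [h2, min_eq_left (by omega)]

theorem waveTree_nil (h : IsTwoWaveQuad M1 M2 a b c d) (hp : p = a ∨ p = b) :
    waveTree M1 M2 p = .nil := by
  have := h.one_le
  have := h.1
  have := h.2.1
  have := h.2.2.1
  obtain ⟨p, rfl⟩ : ∃ p', p = p' + 1 := ⟨p - 1, by omega⟩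
  have h4 : ¬ ∃ q : ℕ × ℕ × ℕ, IsTwoWaveQuad M1 M2 q.1 q.2.1 q.2.2 (p + 1) := by
    rintro ⟨q, hq⟩
    have := hq.eq_of_mem h (p + 1) (by omega) (by omega)
    omega
  have h3 : ¬ ∃ q : ℕ × ℕ × ℕ, IsTwoWaveQuad M1 M2 q.1 q.2.1 (p + 1) q.2.2 := by
    rintro ⟨q, hq⟩
    have := hq.eq_of_mem h (p + 1) (by omega) (by omega)
    omega
  rw [waveTree, dif_neg h4, dif_neg h3, if_pos ⟨a, b, c, d, h, hp⟩]

theorem IsTwoWaveQuad.not_isInt (h : IsTwoWaveQuad M1 M2 a b c d)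
    (hp : p = a ∨ p = b ∨ p = c ∨ p = d) : ¬ M1.IsInt p := by
  obtain ⟨-, -, -, r1, r2, -, -⟩ := h
  rintro ⟨h1, h2⟩
  rcases hp with rfl | rfl | rfl | rfl
  · exact h1 ⟨_, r1⟩
  · exact h2 ⟨_, r1⟩
  · exact h1 ⟨_, r2⟩
  · exact h2 ⟨_, r2⟩

theorem waveTree_int (hp : 1 ≤ p) (h : M1.IsInt p) :
    waveTree M1 M2 p = .int (waveTree M1 M2 (p - 1)) p := by
  obtain ⟨p, rfl⟩ : ∃ p', p = p' + 1 := ⟨p - 1, by omega⟩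
  rw [waveTree, dif_neg, dif_neg, if_neg, Nat.add_sub_cancel]
  · rintro ⟨a, b, c, d, hq, hp⟩
    exact hq.not_isInt (by omega) h
  · rintro ⟨q, hq⟩
    exact hq.not_isInt (by omega) h
  · rintro ⟨q, hq⟩
    exact hq.not_isInt (by omega) h

/-- The factor between two boundaries. -/
def posFactor (s e : ℕ) : FreeMonoid ℕ := FreeMonoid.ofList (List.range' (s + 1) (e - s))

theorem posFactor_self (s : ℕ) : posFactor s s = 1 := by
  simp [posFactor]

theorem posFactor_mul_of {s p : ℕ} (h : s < p) :
    posFactor s (p - 1) * FreeMonoid.of p = posFactor s p := by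
  obtain ⟨k, rfl⟩ : ∃ k, p = s + 1 + k := ⟨p - s - 1, by omega⟩
  rw [posFactor, posFactor, show s + 1 + k - s = k + 1 by omega,
    show s + 1 + k - 1 - s = k by omega, List.range'_concat, Nat.one_mul]
  rfl

theorem posFactor_mul {s m e : ℕ} (h : s ≤ m) (h' : m ≤ e) :
    posFactor s m * posFactor m e = posFactor s e := by
  rw [posFactor, posFactor, posFactor, show e - s = (m - s) + (e - m) by omega,
    ← List.range'_append_1, show s + 1 + (m - s) = m + 1 by omega]
  rfl

variable (M1 M2) in
/-- The term `t` describes the part of the structure seen just after position `p`. -/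
def WTree.CoversUpTo (t : WTree) (p : ℕ) : Prop :=
  ∃ s e, M2.IsTop s p ∧ M1.IsTop e p ∧
    ((e ≤ s ∧ t.segs = (false, posFactor s p, 1)) ∨
      (s < e ∧ ∃ a b d, IsTwoWaveQuad M1 M2 a b e d ∧ s < b ∧
        t.segs = (true, posFactor s (b - 1), posFactor e p)))

theorem posFactor_mul_of_mul {s p m : ℕ} (h : s < p) (h' : p ≤ m) :
    posFactor s (p - 1) * FreeMonoid.of p * posFactor p m = posFactor s m := by
  rw [posFactor_mul_of h, posFactor_mul h.le h']

/-- If no linked 2-wave is pending inside a 2-wave, then the same arch of `M1` encloses its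
first and its third position. -/
theorem IsTwoWaveQuad.isTop_of_le (hw : IsWaveStructure M1 M2)
    (h : IsTwoWaveQuad M1 M2 a b c d) {e : ℕ} (he : M1.IsTop e (c - 1)) (heb : e ≤ b) :
    M1.IsTop e (a - 1) := by
  have ha := h.one_le
  obtain ⟨h1, h2, h3, r1, r2, r3, r4⟩ := h
  have hea : e ≤ a - 1 ∧ (e = 0 ∨ ∃ f, a - 1 < f ∧ M1.rel e f) := by
    obtain ⟨-, rfl | ⟨f, hf, hef⟩, -⟩ := he
    · exact ⟨by omega, Or.inl rfl⟩
    · have u := M1.unique _ _ _ _ hef r1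
      have v := M1.noncrossing _ _ _ _ r1 hef
      exact ⟨by omega, Or.inr ⟨f, by omega, hef⟩⟩
  refine ⟨hea.1, hea.2, fun x y hxy hx hxa => ?_⟩
  by_contra hy
  have u := M1.unique _ _ _ _ hxy r1
  have hby := M1.noncrossing _ _ _ _ hxy r1 (by omega) (by omega)
  have hyc := he.2.2 x y hxy hx (by omega)
  obtain ⟨j1, j2, j3, j4, ⟨l1, l2, l3, q1, q2, q3, q4⟩, ⟨rfl, rfl⟩ | ⟨rfl, rfl⟩⟩ :=
    hw.1 x y hxy
  · have hj3 := M2.noncrossing _ _ _ _ r3 q3 (by omega) (by omega)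
    have hj4 := M2.noncrossing _ _ _ _ q4 r4 (by omega) (by omega)
    have := he.call_le q2 (by omega) (by omega)
    omega
  · have := M2.noncrossing _ _ _ _ q4 r3 (by omega) (by omega)
    omega

/-- A 2-wave linking the part between `b` and `c` to the outside of `(a, b, c, d)` forces the
innermost open arch of `M1` before `a` to be opened before that of `M2`. -/
theorem IsTwoWaveQuad.top_le_top (hw : IsWaveStructure M1 M2)
    (h : IsTwoWaveQuad M1 M2 a b c d) {i j k l s e : ℕ} (h' : IsTwoWaveQuad M1 M2 i j k l)
    (hbj : b < j) (hkc : k < c) (hcl : c ≤ l) (he : M1.IsTop e (a - 1))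
    (hs : M2.IsTop s (a - 1)) : e ≤ s := by
  have ha := h.one_le
  obtain ⟨h1, h2, h3, r1, r2, r3, r4⟩ := h
  obtain ⟨l1, l2, l3, q1, q2, q3, q4⟩ := h'
  have u1 := M1.unique _ _ _ _ q2 r2
  have u2 := M1.unique _ _ _ _ q1 r1
  have n1 := M1.noncrossing _ _ _ _ r1 q1
  have n2 := M2.noncrossing _ _ _ _ r3 q4
  have hia : i < a := by omega
  have his : i ≤ s := hs.call_le q4 (by omega) (by omega)
  by_contra hes
  obtain ⟨he1, rfl | ⟨f, hf, hef⟩, -⟩ := he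
  · omega
  obtain ⟨m1, m2, m3, m4, ⟨o1, o2, o3, p1, p2, p3, p4⟩, ⟨rfl, rfl⟩ | ⟨rfl, rfl⟩⟩ :=
    hw.1 e f hef
  · have := hs.call_le p4 (by omega) (by omega)
    omega
  · have u3 := M1.unique _ _ _ _ p2 r1
    have n3 := M1.noncrossing _ _ _ _ p2 r1 (by omega) (by omega)
    have n4 := M1.noncrossing _ _ _ _ q1 p2 (by omega) (by omega)
    have n5 := M2.noncrossing _ _ _ _ p4 r3 (by omega) (by omega)
    omega

theorem coversUpTo_waveTree (hw : IsWaveStructure M1 M2) (p : ℕ) :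
    (waveTree M1 M2 p).CoversUpTo M1 M2 p := by
  induction p using hw.position_induction with
  | zero =>
    refine ⟨0, 0, ⟨le_rfl, Or.inl rfl, by omega⟩, ⟨le_rfl, Or.inl rfl, by omega⟩,
      Or.inl ⟨le_rfl, ?_⟩⟩
    rw [waveTree, posFactor_self]
    rfl
  | int p hp h1 h2 ih =>
    obtain ⟨s, e, hs, he, h⟩ := ih
    refine ⟨s, e, hs.int h2 hp, he.int h1 hp, ?_⟩
    have := hs.1
    have := he.1
    rw [waveTree_int hp h1]
    rcases h with ⟨hes, h⟩ | ⟨hes, a, b, d, hq, hb, h⟩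
    · refine Or.inl ⟨hes, ?_⟩
      rw [← posFactor_mul_of (by omega), ← one_mul (1 : FreeMonoid ℕ)]
      change WaveAlg.int _ (WTree.segs _) _ = _
      rw [h]
      simp [WTree.monoidAlg]
    · refine Or.inr ⟨hes, a, b, d, hq, hb, ?_⟩
      rw [← posFactor_mul_of (s := e) (by omega)]
      change WaveAlg.int _ (WTree.segs _) _ = _
      rw [h]
      simp [WTree.monoidAlg]
  | one a b c d h =>
    refine ⟨a, a, Matching.isTop_call h.2.2.2.2.2.2, Matching.isTop_call h.2.2.2.1,
      Or.inl ⟨le_rfl, ?_⟩⟩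
    rw [waveTree_nil h (by omega), posFactor_self]
    rfl
  | two a b c d h =>
    obtain ⟨e, he⟩ := M1.exists_isTop b
    refine ⟨b, e, Matching.isTop_call h.2.2.2.2.2.1, he, Or.inl ⟨he.1, ?_⟩⟩
    rw [waveTree_nil h (by omega), posFactor_self]
    rfl
  | three a b c d h ih =>
    obtain ⟨h1, h2, h3, r1, r2, r3, r4⟩ := h
    obtain ⟨s, e, hs, he, ih⟩ := ih
    obtain rfl := he.unique (Matching.isTop_before_ret r1)
    have hes : e ≤ s := hs.call_le r4 (by omega) (by omega)
    have hs' := hs.1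
    rcases ih with ⟨-, ih⟩ | ⟨hse, -⟩
    · refine ⟨s, c, hs.ret r3, Matching.isTop_call r2, Or.inr ⟨by omega, e, b, d,
        ⟨h1, h2, h3, r1, r2, r3, r4⟩, by omega, ?_⟩⟩
      rw [waveTree_three ⟨h1, h2, h3, r1, r2, r3, r4⟩, posFactor_self]
      change WaveAlg.base _ (WTree.segs _) = _
      rw [ih]
      rfl
    · omega
  | four a b c d h iha ihc ihd =>
    rw [waveTree_four h]
    have hq := h
    obtain ⟨h1, h2, h3, r1, r2, r3, r4⟩ := h
    obtain ⟨s2, e2, hs2, he2, ihd⟩ := ihd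
    obtain rfl := hs2.unique (Matching.isTop_before_ret r4)
    obtain rfl := he2.unique (Matching.isTop_before_ret r2)
    obtain ⟨a', b', d', hq', -, hU⟩ : ∃ a' b' d', IsTwoWaveQuad M1 M2 a' b' e2 d' ∧ s2 < b' ∧
        (waveTree M1 M2 (d - 1)).segs = (true, posFactor s2 (b' - 1), posFactor e2 (d - 1)) := by
      rcases ihd with ⟨h, -⟩ | ⟨-, h⟩
      · omega
      · exact h
    obtain ⟨-, rfl, -, -⟩ := hq.eq_of_mem hq' e2 (by omega) (by omega)
    obtain ⟨s1, e1, hs1, he1, ihc⟩ := ihc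
    obtain rfl := hs1.unique (Matching.isTop_before_ret r3)
    obtain ⟨s, e, hs, he, iha⟩ := iha
    have ha := hq.one_le
    have hs' := hs.1
    have he' := he.1
    refine ⟨s, e1, hs.ret r4, he1.ret r2, ?_⟩
    change (e1 ≤ s ∧ WTree.nodeSegs (WTree.segs _) _ _ _ _ (WTree.segs _) (WTree.segs _) = _) ∨
      (s < e1 ∧ ∃ a b d_1, IsTwoWaveQuad M1 M2 a b e1 d_1 ∧ s < b ∧
      WTree.nodeSegs (WTree.segs _) _ _ _ _ (WTree.segs _) (WTree.segs _) = _)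
    rw [hU]
    rcases ihc with ⟨hes1, hS⟩ | ⟨hes1, i, j, l, hq1, hj, hS⟩
    · obtain rfl := (hq.isTop_of_le hw he1 hes1).unique he
      rw [hS]
      rcases iha with ⟨hes, hT⟩ | ⟨hes, a'', b'', d'', hq'', hb'', hT⟩
      · refine Or.inl ⟨hes, ?_⟩
        rw [hT]
        simp only [WTree.nodeSegs, id_eq, mul_one]
        rw [posFactor_mul_of_mul, posFactor_mul_of_mul, posFactor_mul_of_mul, posFactor_mul_of] <;> omega
      · refine Or.inr ⟨hes, a'', b'', d'', hq'', hb'', ?_⟩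
        rw [hT]
        simp only [WTree.nodeSegs, id_eq, mul_one]
        rw [posFactor_mul_of_mul, posFactor_mul_of_mul, posFactor_mul_of_mul, posFactor_mul_of] <;> omega
    · have := he1.1
      have hjl := hq1.2.1
      have hes : e ≤ s := by
        refine hq.top_le_top hw hq1 hj (by omega) ?_ he hs
        rcases he1.2.1 with h0 | ⟨f, hf, hef⟩
        · omega
        · have := M1.unique _ _ _ _ hef hq1.2.2.2.2.1
          omega
      refine Or.inr ⟨by omega, i, j, l, hq1, by omega, ?_⟩
      rcases iha with ⟨-, hT⟩ | ⟨hes', -⟩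
      · rw [hT, hS]
        simp only [WTree.nodeSegs, id_eq, one_mul]
        rw [posFactor_mul_of_mul, posFactor_mul_of_mul, posFactor_mul_of_mul, posFactor_mul_of] <;> omega
      · omega

theorem segs_waveTree (hw : IsWaveStructure M1 M2) :
    (waveTree M1 M2 n).segs = (false, posFactor 0 n, 1) := by
  obtain ⟨s, e, hs, he, h⟩ := coversUpTo_waveTree hw n
  obtain rfl := hs.eq_zero
  obtain rfl := he.eq_zero
  rcases h with ⟨-, h⟩ | ⟨h, -⟩
  · exact h
  · omega

theorem quads_waveTree (hw : IsWaveStructure M1 M2) (p : ℕ) :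
    ∀ q ∈ (waveTree M1 M2 p).quads, IsTwoWaveQuad M1 M2 q.1 q.2.1 q.2.2.1 q.2.2.2 := by
  induction p using hw.position_induction with
  | zero =>
    rw [waveTree]
    exact fun q hq => hq.elim
  | int p hp h1 h2 ih =>
    rw [waveTree_int hp h1]
    exact ih
  | one a b c d h =>
    rw [waveTree_nil h (by omega)]
    exact fun q hq => hq.elim
  | two a b c d h =>
    rw [waveTree_nil h (by omega)]
    exact fun q hq => hq.elim
  | three a b c d h ih =>
    rw [waveTree_three h]
    exact ih
  | four a b c d h iha ihc ihd =>
    rw [waveTree_four h]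
    simp only [WTree.quads, Set.mem_insert_iff, Set.mem_union]
    rintro q (rfl | (hq | hq) | hq)
    · exact h
    · exact iha q hq
    · exact ihd q hq
    · exact ihc q hq

theorem ints_waveTree (hw : IsWaveStructure M1 M2) (p : ℕ) :
    ∀ q ∈ (waveTree M1 M2 p).ints, M1.IsInt q := by
  induction p using hw.position_induction with
  | zero =>
    rw [waveTree]
    exact fun q hq => hq.elim
  | int p hp h1 h2 ih =>
    rw [waveTree_int hp h1]
    simp only [WTree.ints, Set.mem_insert_iff]
    rintro q (rfl | hq)
    · exact h1
    · exact ih q hq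
  | one a b c d h =>
    rw [waveTree_nil h (by omega)]
    exact fun q hq => hq.elim
  | two a b c d h =>
    rw [waveTree_nil h (by omega)]
    exact fun q hq => hq.elim
  | three a b c d h ih =>
    rw [waveTree_three h]
    exact ih
  | four a b c d h iha ihc ihd =>
    rw [waveTree_four h]
    simp only [WTree.ints, Set.mem_union]
    rintro q ((hq | hq) | hq)
    · exact iha q hq
    · exact ihd q hq
    · exact ihc q hq

theorem mem_pos_waveTree (hw : IsWaveStructure M1 M2) (p : ℕ) :
    p ∈ (waveTree M1 M2 n).pos ↔ 1 ≤ p ∧ p ≤ n := by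
  rw [WTree.mem_pos_iff, segs_waveTree hw]
  simp [posFactor]
  omega

theorem mem_quads_waveTree_iff (hw : IsWaveStructure M1 M2) (q : ℕ × ℕ × ℕ × ℕ) :
    q ∈ (waveTree M1 M2 n).quads ↔ IsTwoWaveQuad M1 M2 q.1 q.2.1 q.2.2.1 q.2.2.2 := by
  refine ⟨quads_waveTree hw n q, fun h => ?_⟩
  have hpos : q.1 ∈ (waveTree M1 M2 n).pos := by
    have := h.le
    have := h.1
    have := h.2.1
    have := h.2.2.1
    exact (mem_pos_waveTree hw _).2 ⟨h.one_le, by omega⟩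
  rcases WTree.mem_pos_cases _ _ hpos with hi | ⟨q', hq', hm⟩
  · exact absurd (ints_waveTree hw n _ hi) (h.not_isInt (Or.inl rfl))
  · obtain ⟨h1, h2, h3, h4⟩ := h.eq_of_mem (quads_waveTree hw n q' hq') q.1 (Or.inl rfl) hm
    rwa [show q = q' from Prod.ext h1 (Prod.ext h2 (Prod.ext h3 h4))]

end WaveTree

theorem describes_waveTree {α : Type} {ω : TwoNW α} (hw : ω.IsWaveWord) :
    (waveTree ω.M1 ω.M2 ω.word.length).Describes ω where
  disj := by
    apply WTree.disj_of_nodup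
    rw [segs_waveTree hw]
    simp [posFactor, List.nodup_range']
  segs_eq := by
    rw [segs_waveTree hw]
    simp [posFactor]
  mem_pos := mem_pos_waveTree hw
  rel1 i j := by
    constructor
    · intro h
      obtain ⟨a, b, c, d, hq, h⟩ := hw.1 i j h
      exact ⟨(a, b, c, d), (mem_quads_waveTree_iff hw _).2 hq, h⟩
    · rintro ⟨q, hq, ⟨rfl, rfl⟩ | ⟨rfl, rfl⟩⟩
      · exact ((mem_quads_waveTree_iff hw _).1 hq).2.2.2.1
      · exact ((mem_quads_waveTree_iff hw _).1 hq).2.2.2.2.1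
  rel2 i j := by
    constructor
    · intro h
      obtain ⟨a, b, c, d, hq, h⟩ := hw.2 i j h
      exact ⟨(a, b, c, d), (mem_quads_waveTree_iff hw _).2 hq, h⟩
    · rintro ⟨q, hq, ⟨rfl, rfl⟩ | ⟨rfl, rfl⟩⟩
      · exact ((mem_quads_waveTree_iff hw _).1 hq).2.2.2.2.2.1
      · exact ((mem_quads_waveTree_iff hw _).1 hq).2.2.2.2.2.2

/-! ### From finite algebras to automata -/

namespace Matching

variable {n : ℕ} {M : Matching n} {i j : ℕ}

theorem rel_iff_eq (h : M.rel i j) (k : ℕ) : M.rel k j ↔ k = i := by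
  refine ⟨fun h' => (M.unique _ _ _ _ h' h (by omega)).1, ?_⟩
  rintro rfl
  exact h

theorem not_rel_call (h : M.rel i j) (k : ℕ) : ¬ M.rel k i := fun h' => by
  have := M.unique _ _ _ _ h' h (by omega)
  have := M.ordered _ _ h
  omega

theorem not_isCall_ret (h : M.rel i j) : ¬ M.IsCall j :=
  fun ⟨_, h'⟩ => not_rel_call h' _ h

theorem not_isInt_call (h : M.rel i j) : ¬ M.IsInt i := fun h' => h'.1 ⟨_, h⟩

theorem not_isInt_ret (h : M.rel i j) : ¬ M.IsInt j := fun h' => h'.2 ⟨_, h⟩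

theorem IsInt.not_rel (h : M.IsInt i) (k : ℕ) : ¬ M.rel k i := fun h' => h.2 ⟨_, h'⟩

end Matching

namespace TwoNWA

open Matching

variable {α Q P : Type} (A : TwoNWA α Q P) {ω : TwoNW α} {ℓ : ℕ → Q} {h1 h2 : ℕ → P}
  {a b c d p : ℕ}

theorem runAt_one_iff (h : IsTwoWaveQuad ω.M1 ω.M2 a b c d) :
    A.RunAt ω ℓ h1 h2 a ↔
      ∃ x, ω.word[a - 1]? = some x ∧ ((ℓ (a - 1), x), (h1 a, h2 a, ℓ a)) ∈ A.Δcc := by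
  obtain ⟨-, -, -, r1, -, -, r4⟩ := h
  have e1 : ω.M1.IsCall a := ⟨_, r1⟩
  have e2 : ω.M2.IsCall a := ⟨_, r4⟩
  simp [RunAt, e1, e2, not_rel_call r1, not_rel_call r4, not_isInt_call r1, not_isInt_call r4]

theorem runAt_two_iff (h : IsTwoWaveQuad ω.M1 ω.M2 a b c d) :
    A.RunAt ω ℓ h1 h2 b ↔
      ∃ x, ω.word[b - 1]? = some x ∧ ((ℓ (b - 1), h1 a, x), (h2 b, ℓ b)) ∈ A.Δrc := by
  obtain ⟨-, -, -, r1, -, r3, -⟩ := h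
  have e2 : ω.M2.IsCall b := ⟨_, r3⟩
  simp [RunAt, e2, not_isCall_ret r1, rel_iff_eq r1, not_rel_call r3, not_isInt_ret r1,
    not_isInt_call r3]

theorem runAt_three_iff (h : IsTwoWaveQuad ω.M1 ω.M2 a b c d) :
    A.RunAt ω ℓ h1 h2 c ↔
      ∃ x, ω.word[c - 1]? = some x ∧ ((ℓ (c - 1), h2 b, x), (h1 c, ℓ c)) ∈ A.Δcr := by
  obtain ⟨-, -, -, -, r2, r3, -⟩ := h
  have e1 : ω.M1.IsCall c := ⟨_, r2⟩
  simp [RunAt, e1, not_isCall_ret r3, rel_iff_eq r3, not_rel_call r2, not_isInt_ret r3,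
    not_isInt_call r2]

theorem runAt_four_iff (h : IsTwoWaveQuad ω.M1 ω.M2 a b c d) :
    A.RunAt ω ℓ h1 h2 d ↔
      ∃ x, ω.word[d - 1]? = some x ∧ ((ℓ (d - 1), h1 c, h2 a, x), ℓ d) ∈ A.Δrr := by
  obtain ⟨-, -, -, -, r2, -, r4⟩ := h
  simp [RunAt, not_isCall_ret r2, not_isCall_ret r4, rel_iff_eq r2, rel_iff_eq r4,
    not_isInt_ret r2, not_isInt_ret r4]

theorem runAt_int_iff (i1 : ω.M1.IsInt p) (i2 : ω.M2.IsInt p) :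
    A.RunAt ω ℓ h1 h2 p ↔
      ∃ x, ω.word[p - 1]? = some x ∧ ((ℓ (p - 1), x), ℓ p) ∈ A.Δii := by
  simp [RunAt, i1, i2, i1.1, i2.1, i1.not_rel, i2.not_rel]

end TwoNWA

namespace WaveAlg

variable {α Λ X : Type} (A : WaveAlg Λ X)

/-- The automaton evaluating the term of a 2-wave word in the algebra `A`. Hierarchical states
store the value reached before the call and the letters met so far in the 2-wave. -/
def toNWA (lab : Option α → Λ) (F : Set X) : TwoNWA α X (X × Option α × Option α) where
  init := {A.nil}
  final := F
  Δcc := {t | t.2 = ((t.1.1, some t.1.2, some t.1.2), (t.1.1, some t.1.2, some t.1.2), A.nil)}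
  Δrc := {t | t.2 = ((t.1.1, some t.1.2.2, some t.1.2.2), A.nil)}
  Δcr := {t | t.2 = ((t.1.1, t.1.2.1.2.1, some t.1.2.2), A.base t.1.2.1.1)}
  Δrr := {t | t.2 = A.node t.1.2.2.1.1 (lab t.1.2.2.1.2.1) (lab t.1.2.1.2.1)
    (lab t.1.2.1.2.2) (lab (some t.1.2.2.2)) t.1.1 t.1.2.1.1}
  Δci := ∅
  Δic := ∅
  Δri := ∅
  Δir := ∅
  Δii := {t | t.2 = A.int t.1.1 (lab (some t.1.2))}

variable {lab : Option α → Λ} {F : Set X} {ω : TwoNW α} {f : ℕ → Λ}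

theorem eq_eval_of_isRun (hw : ω.IsWaveWord)
    (hf : ∀ i, 1 ≤ i → f i = lab ω.word[i - 1]?) {ℓ : ℕ → X}
    {h1 h2 : ℕ → X × Option α × Option α} (hr : (A.toNWA lab F).IsRun ω ℓ h1 h2) (h0 : ℓ 0 = A.nil) (p : ℕ)
    (hp : p ≤ ω.word.length) : ℓ p = (waveTree ω.M1 ω.M2 p).eval A f := by
  induction p using IsWaveStructure.position_induction hw with
  | zero =>
    rw [h0, waveTree]
    rfl
  | int p hp1 i1 i2 ih =>
    obtain ⟨x, hx, h⟩ := (TwoNWA.runAt_int_iff _ i1 i2).1 (hr p hp1 hp)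
    have h : ℓ p = _ := h
    rw [h, ih (by omega), waveTree_int hp1 i1]
    simp only [WTree.eval]
    rw [hf p hp1, hx]
  | one a b c d h =>
    obtain ⟨x, hx, h'⟩ := (TwoNWA.runAt_one_iff _ h).1 (hr a h.one_le hp)
    rw [waveTree_nil h (by omega)]
    exact congrArg (fun t => t.2.2) (show (_, _, _) = (_, _, _) from h')
  | two a b c d h =>
    have ha := h.one_le
    have hab := h.1
    obtain ⟨x, hx, h'⟩ := (TwoNWA.runAt_two_iff _ h).1 (hr b (by omega) hp)
    rw [waveTree_nil h (by omega)]
    exact congrArg (fun t => t.2) (show (_, _) = (_, _) from h')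
  | three a b c d h ih =>
    have ha := h.one_le
    have hab := h.1
    have hbc := h.2.1
    obtain ⟨x, hx, h'⟩ := (TwoNWA.runAt_two_iff _ h).1 (hr b (by omega) (by omega))
    obtain ⟨y, hy, h''⟩ := (TwoNWA.runAt_three_iff _ h).1 (hr c (by omega) hp)
    have h' : (h2 b, ℓ b) = _ := h'
    have h'' : (h1 c, ℓ c) = _ := h''
    simp only [Prod.mk.injEq] at h' h''
    rw [waveTree_three h, h''.2, h'.1]
    exact congrArg A.base (ih (by omega))
  | four a b c d h iha ihc ihd =>
    have ha := h.one_le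
    have hab := h.1
    have hbc := h.2.1
    have hcd := h.2.2.1
    obtain ⟨x, hx, hra⟩ := (TwoNWA.runAt_one_iff _ h).1 (hr a (by omega) (by omega))
    obtain ⟨y, hy, hrb⟩ := (TwoNWA.runAt_two_iff _ h).1 (hr b (by omega) (by omega))
    obtain ⟨z, hz, hrc⟩ := (TwoNWA.runAt_three_iff _ h).1 (hr c (by omega) (by omega))
    obtain ⟨u, hu, hrd⟩ := (TwoNWA.runAt_four_iff _ h).1 (hr d (by omega) (by omega))
    have hra : (h1 a, h2 a, ℓ a) = _ := hra
    have hrb : (h2 b, ℓ b) = _ := hrb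
    have hrc : (h1 c, ℓ c) = _ := hrc
    have hrd : ℓ d = _ := hrd
    simp only [Prod.mk.injEq] at hra hrb hrc
    rw [waveTree_four h, hrd, hrc.1, hra.2.1, hrb.1]
    simp only [WTree.eval]
    rw [iha (by omega), ihc (by omega), ihd (by omega), hf a (by omega), hx,
      hf b (by omega), hy, hf c (by omega), hz, hf d (by omega), hu]

theorem exists_isRun (hw : ω.IsWaveWord)
    (hf : ∀ i, 1 ≤ i → f i = lab ω.word[i - 1]?) :
    ∃ h1 h2, (A.toNWA lab F).IsRun ω (fun p => (waveTree ω.M1 ω.M2 p).eval A f) h1 h2 := by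
  classical
  have hlet : ∀ i, 1 ≤ i → i ≤ ω.word.length → ∃ x, ω.word[i - 1]? = some x :=
    fun i hi hi' => ⟨_, List.getElem?_eq_getElem (by omega)⟩
  set g : ℕ → Option α := fun i => ω.word[i - 1]?
  have hg : ∀ i, 1 ≤ i → f i = lab (g i) := hf
  set e : ℕ → X := fun p => (waveTree ω.M1 ω.M2 p).eval A f with he
  have hpart : ∀ i, ∃ b, ∀ j, ω.M2.rel j i → b = j := fun i => by
    by_cases h : ∃ j, ω.M2.rel j i
    · obtain ⟨j, hj⟩ := h
      exact ⟨j, fun k hk => ((Matching.rel_iff_eq hj k).1 hk).symm⟩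
    · exact ⟨0, fun j hj => absurd ⟨j, hj⟩ h⟩
  choose r hr using hpart
  refine ⟨fun i => (e (i - 1), g (if ω.M2.IsCall i then i else r i), g i),
    fun i => (e (i - 1), g i, g i), fun p hp hp' => ?_⟩
  obtain ⟨x, hx⟩ := hlet p hp hp'
  rcases hw.position_cases p with ⟨i1, i2⟩ | ⟨a, b, c, d, h, rfl | rfl | rfl | rfl⟩
  · refine (TwoNWA.runAt_int_iff _ i1 i2).2 ⟨x, hx, ?_⟩
    change e p = A.int (e (p - 1)) (lab (some x))
    rw [← hx, ← hf p hp, he]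
    simp only
    rw [waveTree_int hp i1]
    rfl
  · refine (TwoNWA.runAt_one_iff _ h).2 ⟨x, hx, ?_⟩
    have hc : ω.M2.IsCall p := ⟨_, h.2.2.2.2.2.2⟩
    change (_, _, e p) = (_, _, _)
    rw [if_pos hc, show g p = some x from hx, he]
    simp only
    rw [waveTree_nil (p := p) h (by omega)]
    rfl
  · refine (TwoNWA.runAt_two_iff _ h).2 ⟨x, hx, ?_⟩
    change (_, e p) = (_, _)
    rw [show g p = some x from hx, he]
    simp only
    rw [waveTree_nil (p := p) h (by omega)]
    rfl
  · refine (TwoNWA.runAt_three_iff _ h).2 ⟨x, hx, ?_⟩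
    have hrel := h.2.2.2.2.2.1
    change (_, e p) = (_, A.base (e (b - 1)))
    rw [if_neg (Matching.not_isCall_ret hrel), hr p b hrel, show g p = some x from hx, he]
    simp only
    rw [waveTree_three h]
    rfl
  · refine (TwoNWA.runAt_four_iff _ h).2 ⟨x, hx, ?_⟩
    have hrel := h.2.2.2.2.2.1
    have ha := h.one_le
    have hab := h.1
    have hbc := h.2.1
    have hcd := h.2.2.1
    change e p = A.node (e (a - 1)) (lab (g a)) (lab (g (if ω.M2.IsCall c then c else r c)))
      (lab (g c)) (lab (some x)) (e (p - 1)) (e (c - 1))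
    rw [if_neg (Matching.not_isCall_ret hrel), hr c b hrel, ← hx, ← hg a (by omega),
      ← hg b (by omega), ← hg c (by omega), ← hf p hp, he]
    simp only
    rw [waveTree_four h]
    rfl

theorem accepts_toNWA_iff (hw : ω.IsWaveWord)
    (hf : ∀ i, 1 ≤ i → f i = lab ω.word[i - 1]?) :
    (A.toNWA lab F).Accepts ω ↔ (waveTree ω.M1 ω.M2 ω.word.length).eval A f ∈ F := by
  constructor
  · rintro ⟨ℓ, h1, h2, hr, h0, hn⟩
    rwa [← A.eq_eval_of_isRun hw hf hr h0 _ le_rfl]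
  · intro h
    obtain ⟨h1, h2, hr⟩ := A.exists_isRun (F := F) hw hf
    refine ⟨_, h1, h2, hr, ?_, h⟩
    change (waveTree _ _ 0).eval A f = A.nil
    rw [waveTree]
    rfl

end WaveAlg

/-- Satisfaction depends only on the values of the free variables. -/
theorem MSO.sat_congr {α : Type} {ω : TwoNW α} (φ : MSO α) {ν1 ν1' : ℕ → ℕ}
    {ν2 ν2' : ℕ → Set ℕ} (h1 : ∀ x ∈ φ.freeFO, ν1 x = ν1' x)
    (h2 : ∀ X ∈ φ.freeSO, ν2 X = ν2' X) : MSO.Sat ω ν1 ν2 φ ↔ MSO.Sat ω ν1' ν2' φ := by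
  induction φ generalizing ν1 ν1' ν2 ν2' with
  | qa a x => simp_all [MSO.Sat, MSO.freeFO]
  | lt x y => simp_all [MSO.Sat, MSO.freeFO]
  | mem X x => simp_all [MSO.Sat, MSO.freeFO, MSO.freeSO]
  | m1 x y => simp_all [MSO.Sat, MSO.freeFO]
  | m2 x y => simp_all [MSO.Sat, MSO.freeFO]
  | not φ ih => exact not_congr (ih h1 h2)
  | and φ ψ ihφ ihψ =>
    exact and_congr (ihφ (fun x hx => h1 x (Or.inl hx)) fun X hX => h2 X (Or.inl hX))
      (ihψ (fun x hx => h1 x (Or.inr hx)) fun X hX => h2 X (Or.inr hX))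
  | exFO x φ ih =>
    refine exists_congr fun i => and_congr_right fun _ => and_congr_right fun _ =>
      ih (fun y hy => ?_) h2
    by_cases hyx : y = x
    · simp [hyx]
    · simp [hyx, h1 y ⟨hy, hyx⟩]
  | exSO X φ ih =>
    refine exists_congr fun I => and_congr_right fun _ => ih h1 fun Y hY => ?_
    by_cases hYX : Y = X
    · simp [hYX]
    · simp [hYX, h2 Y ⟨hY, hYX⟩]

theorem MSO.Closed.models_iff {α : Type} {φ : MSO α} (h : φ.Closed) (ω : TwoNW α) (ν1 : ℕ → ℕ)
    (ν2 : ℕ → Set ℕ) : MSO.Models ω φ ↔ MSO.Sat ω ν1 ν2 φ := by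
  refine ⟨fun hm => hm ν1 ν2, fun hs ν1' ν2' => (φ.sat_congr ?_ ?_).1 hs⟩
  · simp [h.1]
  · simp [h.2]

theorem MSO.exists_langWW_eq {α : Type} [Finite α] {φ : MSO α} (h : φ.Closed) :
    ∃ (Q P : Type) (_ : Finite Q) (_ : Finite P) (A : TwoNWA α Q P),
      MSOLangWW φ = A.langWW := by
  obtain ⟨K, ⟨X, hX, A, F, hAF⟩, hK⟩ := φ.exists_waveRecognizable
  let lab : Option α → Option α × Set ℕ × Set ℕ := fun o => (o, ∅, ∅)
  refine ⟨X, X × Option α × Option α, hX, inferInstance, A.toNWA lab F, Set.ext fun ω => ?_⟩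
  refine Iff.trans (and_congr_right fun hw => ?_) and_comm
  have ht := describes_waveTree hw
  rw [h.models_iff ω (fun _ => 0) (fun _ => ∅), ← hK ω _ ht _ _ (by simp [h.1]), ← hAF _ _ ht.disj]
  refine (A.accepts_toNWA_iff hw fun i hi => ?_).symm
  simp only [TwoNW.label, lab, Prod.mk.injEq, true_and]
  constructor
  · ext x
    simp
    omega
  · simp

/-! ### From automata to existential formulas -/

/-- First-order definability of a property of valuations, with free first-order variables in
`V` and free set variables below `N`. -/
def FODefinable {α : Type} (V : Set ℕ) (N : ℕ)
    (R : TwoNW α → (ℕ → ℕ) → (ℕ → Set ℕ) → Prop) : Prop :=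
  ∃ φ : MSO α, φ.IsFO ∧ φ.freeFO ⊆ V ∧ φ.freeSO ⊆ Set.Iio N ∧
    ∀ ω ν1 ν2, (∀ x ∈ V, 1 ≤ ν1 x ∧ ν1 x ≤ ω.word.length) → (MSO.Sat ω ν1 ν2 φ ↔ R ω ν1 ν2)

namespace FODefinable

variable {α : Type} {V W : Set ℕ} {N x y : ℕ}
  {R S : TwoNW α → (ℕ → ℕ) → (ℕ → Set ℕ) → Prop}

theorem congr (h : FODefinable V N R) (hRS : ∀ ω ν1 ν2,
    (∀ x ∈ V, 1 ≤ ν1 x ∧ ν1 x ≤ ω.word.length) → (R ω ν1 ν2 ↔ S ω ν1 ν2)) :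
    FODefinable V N S := by
  obtain ⟨φ, h1, h2, h3, h4⟩ := h
  exact ⟨φ, h1, h2, h3, fun ω ν1 ν2 hν => (h4 ω ν1 ν2 hν).trans (hRS ω ν1 ν2 hν)⟩

theorem mono (h : FODefinable V N R) (hVW : V ⊆ W) : FODefinable W N R := by
  obtain ⟨φ, h1, h2, h3, h4⟩ := h
  exact ⟨φ, h1, h2.trans hVW, h3, fun ω ν1 ν2 hν => h4 ω ν1 ν2 fun x hx => hν x (hVW hx)⟩

theorem not (h : FODefinable V N R) : FODefinable V N fun ω ν1 ν2 => ¬ R ω ν1 ν2 := by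
  obtain ⟨φ, h1, h2, h3, h4⟩ := h
  exact ⟨.not φ, h1, h2, h3, fun ω ν1 ν2 hν => not_congr (h4 ω ν1 ν2 hν)⟩

theorem and (h : FODefinable V N R) (h' : FODefinable V N S) :
    FODefinable V N fun ω ν1 ν2 => R ω ν1 ν2 ∧ S ω ν1 ν2 := by
  obtain ⟨φ, h1, h2, h3, h4⟩ := h
  obtain ⟨ψ, h1', h2', h3', h4'⟩ := h'
  exact ⟨.and φ ψ, ⟨h1, h1'⟩, Set.union_subset h2 h2', Set.union_subset h3 h3',
    fun ω ν1 ν2 hν => and_congr (h4 ω ν1 ν2 hν) (h4' ω ν1 ν2 hν)⟩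

theorem or (h : FODefinable V N R) (h' : FODefinable V N S) :
    FODefinable V N fun ω ν1 ν2 => R ω ν1 ν2 ∨ S ω ν1 ν2 :=
  (h.not.and h'.not).not.congr fun _ _ _ _ => by tauto

theorem exists_position (h : FODefinable (insert x V) N R) :
    FODefinable V N fun ω ν1 ν2 =>
      ∃ i, 1 ≤ i ∧ i ≤ ω.word.length ∧ R ω (Function.update ν1 x i) ν2 := by
  obtain ⟨φ, h1, h2, h3, h4⟩ := h
  refine ⟨.exFO x φ, h1, fun y hy => (h2 hy.1).resolve_left hy.2, h3, fun ω ν1 ν2 hν => ?_⟩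
  refine exists_congr fun i => and_congr_right fun hi => and_congr_right fun hi' =>
    h4 ω _ ν2 fun y hy => ?_
  by_cases hyx : y = x
  · simp [hyx, hi, hi']
  · simpa [hyx] using hν y (hy.resolve_left hyx)

theorem forall_position (h : FODefinable (insert x V) N R) :
    FODefinable V N fun ω ν1 ν2 =>
      ∀ i, 1 ≤ i → i ≤ ω.word.length → R ω (Function.update ν1 x i) ν2 :=
  h.not.exists_position.not.congr fun _ _ _ _ => by push Not; rfl

theorem const (p : Prop) : FODefinable (α := α) V N fun _ _ _ => p := by
  have h : FODefinable (α := α) V N fun _ _ _ => False :=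
    ⟨.exFO 0 (.lt 0 0), trivial, by simp [MSO.freeFO], by simp [MSO.freeSO],
      fun ω ν1 ν2 _ => by simp [MSO.Sat]⟩
  by_cases hp : p
  · exact h.not.congr fun _ _ _ _ => by simp [hp]
  · exact h.congr fun _ _ _ _ => by simp [hp]

theorem exists_finite {ι : Type} [Finite ι]
    {R : ι → TwoNW α → (ℕ → ℕ) → (ℕ → Set ℕ) → Prop} (h : ∀ i, FODefinable V N (R i)) :
    FODefinable V N fun ω ν1 ν2 => ∃ i, R i ω ν1 ν2 := by
  classical
  have := Fintype.ofFinite ι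
  have key : ∀ s : Finset ι, FODefinable V N fun ω ν1 ν2 => ∃ i ∈ s, R i ω ν1 ν2 := by
    intro s
    induction s using Finset.induction_on with
    | empty => exact (const False).congr fun _ _ _ _ => by simp
    | insert a s _ ih => exact ((h a).or ih).congr fun _ _ _ _ => by simp
  exact (key Finset.univ).congr fun _ _ _ _ => by simp

theorem forall_finite {ι : Type} [Finite ι]
    {R : ι → TwoNW α → (ℕ → ℕ) → (ℕ → Set ℕ) → Prop} (h : ∀ i, FODefinable V N (R i)) :
    FODefinable V N fun ω ν1 ν2 => ∀ i, R i ω ν1 ν2 :=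
  (exists_finite fun i => (h i).not).not.congr fun _ _ _ _ => by push Not; rfl

theorem letter (a : α) (hx : x ∈ V) :
    FODefinable V N fun ω ν1 _ => ω.word[ν1 x - 1]? = some a :=
  ⟨.qa a x, trivial, by simpa [MSO.freeFO], by simp [MSO.freeSO], fun _ _ _ _ => Iff.rfl⟩

theorem lt (hx : x ∈ V) (hy : y ∈ V) :
    FODefinable (α := α) V N fun _ ν1 _ => ν1 x < ν1 y :=
  ⟨.lt x y, trivial, by simp [MSO.freeFO, Set.insert_subset_iff, hx, hy], by simp [MSO.freeSO],
    fun _ _ _ _ => Iff.rfl⟩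

theorem mem {X : ℕ} (hx : x ∈ V) (hX : X < N) :
    FODefinable (α := α) V N fun _ ν1 ν2 => ν1 x ∈ ν2 X :=
  ⟨.mem X x, trivial, by simpa [MSO.freeFO], by simpa [MSO.freeSO], fun _ _ _ _ => Iff.rfl⟩

theorem rel1 (hx : x ∈ V) (hy : y ∈ V) :
    FODefinable (α := α) V N fun ω ν1 _ => ω.M1.rel (ν1 x) (ν1 y) :=
  ⟨.m1 x y, trivial, by simp [MSO.freeFO, Set.insert_subset_iff, hx, hy], by simp [MSO.freeSO],
    fun _ _ _ _ => Iff.rfl⟩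

theorem rel2 (hx : x ∈ V) (hy : y ∈ V) :
    FODefinable (α := α) V N fun ω ν1 _ => ω.M2.rel (ν1 x) (ν1 y) :=
  ⟨.m2 x y, trivial, by simp [MSO.freeFO, Set.insert_subset_iff, hx, hy], by simp [MSO.freeSO],
    fun _ _ _ _ => Iff.rfl⟩

theorem isCall {M : ∀ ω : TwoNW α, Matching ω.word.length}
    (hM : ∀ {V x y}, x ∈ V → y ∈ V → FODefinable V N fun ω ν1 _ => (M ω).rel (ν1 x) (ν1 y)) :
    FODefinable {0} N fun ω ν1 _ => (M ω).IsCall (ν1 0) :=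
  (exists_position (x := 1) (hM (x := 0) (y := 1) (by simp) (by simp))).congr
    fun ω ν1 _ _ => by
      simp only [Function.update_self, Function.update_of_ne zero_ne_one]
      refine ⟨fun ⟨i, _, _, h⟩ => ⟨i, h⟩, fun ⟨i, h⟩ => ?_⟩
      have := (M ω).ordered _ _ h
      exact ⟨i, by omega, by omega, h⟩

theorem exists_call {M : ∀ ω : TwoNW α, Matching ω.word.length}
    (hM : ∀ {V x y}, x ∈ V → y ∈ V → FODefinable V N fun ω ν1 _ => (M ω).rel (ν1 x) (ν1 y))
    {T : (ℕ → Set ℕ) → ℕ → Prop}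
    (hT : ∀ {V x}, x ∈ V → FODefinable (α := α) V N fun _ ν1 ν2 => T ν2 (ν1 x)) :
    FODefinable {0} N fun ω ν1 ν2 => ∃ j, (M ω).rel j (ν1 0) ∧ T ν2 j :=
  (exists_position (x := 1) ((hM (x := 1) (y := 0) (by simp) (by simp)).and
    (hT (x := 1) (by simp)))).congr fun ω ν1 _ _ => by
      simp only [Function.update_self, Function.update_of_ne zero_ne_one]
      refine ⟨fun ⟨i, _, _, h⟩ => ⟨i, h⟩, fun ⟨i, h⟩ => ?_⟩
      have := (M ω).ordered _ _ h.1
      exact ⟨i, by omega, by omega, h⟩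

theorem isInt {M : ∀ ω : TwoNW α, Matching ω.word.length}
    (hM : ∀ {V x y}, x ∈ V → y ∈ V → FODefinable V N fun ω ν1 _ => (M ω).rel (ν1 x) (ν1 y)) :
    FODefinable {0} N fun ω ν1 _ => (M ω).IsInt (ν1 0) :=
  (isCall hM).not.and ((exists_call hM (T := fun _ _ => True) fun _ => const True).not.congr
    fun _ _ _ _ => by simp [Matching.IsRet])

/-- A property of the previous position, with a fixed truth value at the first position. -/
theorem pred {T : (ℕ → Set ℕ) → ℕ → Prop} (p : Prop)
    (hT : ∀ {V x}, x ∈ V → FODefinable (α := α) V N fun _ ν1 ν2 => T ν2 (ν1 x)) :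
    FODefinable (α := α) {0} N fun _ ν1 ν2 =>
      (ν1 0 = 1 ∧ p) ∨ (ν1 0 ≠ 1 ∧ T ν2 (ν1 0 - 1)) := by
  have hfirst : FODefinable (α := α) {0} N fun _ ν1 _ => ν1 0 = 1 :=
    (exists_position (x := 1) (lt (x := 1) (y := 0) (by simp) (by simp))).not.congr
      fun ω ν1 _ hν => by
        have := hν 0 rfl
        simp only [Function.update_self, Function.update_of_ne zero_ne_one]
        constructor
        · intro h
          by_contra hne
          exact h ⟨1, by omega, by omega, by omega⟩
        · rintro h ⟨i, h1, -, h2⟩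
          omega
  have hpred : FODefinable (α := α) {0} N fun _ ν1 ν2 => ν1 0 ≠ 1 ∧ T ν2 (ν1 0 - 1) := by
    refine (exists_position (x := 1) ((lt (x := 1) (y := 0) (by simp) (by simp)).and
      ((exists_position (x := 2) ((lt (x := 1) (y := 2) (by simp) (by simp)).and
      (lt (x := 2) (y := 0) (by simp) (by simp)))).not.and (hT (x := 1) (by simp))))).congr ?_
    intro ω ν1 ν2 hν
    have := hν 0 rfl
    have e1 : ∀ i, Function.update ν1 1 i 0 = ν1 0 := fun i => by simp
    have e2 : ∀ i j, Function.update (Function.update ν1 1 i) 2 j 0 = ν1 0 := fun i j => by simp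
    have e3 : ∀ i j, Function.update (Function.update ν1 1 i) 2 j 1 = i := fun i j => by simp
    simp only [Function.update_self, e1, e2, e3]
    constructor
    · rintro ⟨i, h1, h2, h3, h4, h5⟩
      obtain rfl : i = ν1 0 - 1 := by
        by_contra hne
        exact h4 ⟨i + 1, by omega, by omega, by omega, by omega⟩
      exact ⟨by omega, h5⟩
    · rintro ⟨h1, h2⟩
      refine ⟨ν1 0 - 1, by omega, by omega, by omega, ?_, h2⟩
      rintro ⟨j, h3, h4, h5, h6⟩
      omega
  exact (hfirst.and (const p)).or hpred

/-- A property of the last position, with a fixed truth value for the empty word. -/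
theorem last {T : (ℕ → Set ℕ) → ℕ → Prop} (p : Prop)
    (hT : ∀ {V x}, x ∈ V → FODefinable (α := α) V N fun _ ν1 ν2 => T ν2 (ν1 x)) :
    FODefinable (α := α) ∅ N fun ω _ ν2 =>
      (ω.word.length = 0 ∧ p) ∨ (ω.word.length ≠ 0 ∧ T ν2 ω.word.length) := by
  have hempty : FODefinable (α := α) ∅ N fun ω _ _ => ω.word.length = 0 :=
    (exists_position (x := 0) (const True)).not.congr fun ω ν1 _ _ => by
      constructor
      · intro h
        by_contra hne
        exact h ⟨1, by omega, by omega, trivial⟩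
      · rintro h ⟨i, h1, h2, -⟩
        omega
  have hlast : FODefinable (α := α) ∅ N fun ω _ ν2 =>
      ω.word.length ≠ 0 ∧ T ν2 ω.word.length := by
    refine (exists_position (x := 0) ((exists_position (x := 1)
      (lt (x := 0) (y := 1) (by simp) (by simp))).not.and (hT (x := 0) (by simp)))).congr ?_
    intro ω ν1 ν2 _
    simp only [Function.update_self, Function.update_of_ne zero_ne_one]
    constructor
    · rintro ⟨i, h1, h2, h3, h4⟩
      obtain rfl : i = ω.word.length := by
        by_contra hne
        exact h3 ⟨ω.word.length, by omega, by omega, by omega⟩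
      exact ⟨by omega, h4⟩
    · rintro ⟨h1, h2⟩
      refine ⟨ω.word.length, by omega, by omega, ?_, h2⟩
      rintro ⟨j, h3, h4, h5⟩
      omega
  exact (hempty.and (const p)).or hlast

end FODefinable

section DecodeLabel

variable {G : Type} [Nonempty G] {N : ℕ} (e : G ≃ Fin N)

/-- The label of a position encoded by membership in `N` sets. -/
noncomputable def decodeLabel (ν2 : ℕ → Set ℕ) (i : ℕ) : G :=
  Function.invFun (fun g => ({e g} : Set (Fin N))) {X | i ∈ ν2 X}

theorem foDefinable_decodeLabel {α : Type} (g : G) {V : Set ℕ} {x : ℕ} (hx : x ∈ V) :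
    FODefinable (α := α) V N fun _ ν1 ν2 => decodeLabel e ν2 (ν1 x) = g := by
  have h : FODefinable (α := α) V N fun _ ν1 ν2 => ∃ S : Set (Fin N),
      Function.invFun (fun g => ({e g} : Set (Fin N))) S = g ∧
        ∀ X : Fin N, (ν1 x ∈ ν2 X ∧ X ∈ S) ∨ (¬ ν1 x ∈ ν2 X ∧ ¬ X ∈ S) :=
    FODefinable.exists_finite fun S => (FODefinable.const _).and
      (FODefinable.forall_finite fun X => ((FODefinable.mem hx X.2).and (.const _)).or
        ((FODefinable.mem hx X.2).not.and (.const _)))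
  refine h.congr fun ω ν1 ν2 _ => ⟨?_, fun h => ⟨_, h, fun X => ?_⟩⟩
  · rintro ⟨S, hS, h⟩
    rw [← hS, decodeLabel]
    congr 1
    ext X
    have := h X
    simp only [Set.mem_ofPred_eq]
    tauto
  · simp only [Set.mem_ofPred_eq]
    tauto

theorem exists_decodeLabel_eq (lab : ℕ → G) (n : ℕ) :
    ∃ ν2 : ℕ → Set ℕ, (∀ X, ν2 X ⊆ Set.Icc 1 n) ∧
      ∀ i, 1 ≤ i → i ≤ n → decodeLabel e ν2 i = lab i := by
  refine ⟨fun X => {i | i ∈ Set.Icc 1 n ∧ e (lab i) = X}, fun X i hi => hi.1,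
    fun i hi hi' => ?_⟩
  have hinj : Function.Injective fun g => ({e g} : Set (Fin N)) :=
    fun g g' h => e.injective (Set.singleton_injective h)
  rw [decodeLabel, ← Function.leftInverse_invFun hinj (lab i)]
  congr 1
  ext X
  simp [hi, hi', Fin.ext_iff, eq_comm]

end DecodeLabel

namespace TwoNWA

variable {α Q P : Type} (A : TwoNWA α Q P)

theorem RunAt.congr {A : TwoNWA α Q P} {ω : TwoNW α} {ℓ ℓ' : ℕ → Q} {h1 h2 h1' h2' : ℕ → P}
    {i : ℕ} (h : A.RunAt ω ℓ h1 h2 i) (hi : 1 ≤ i) (hi' : i ≤ ω.word.length)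
    (hℓ : ∀ j ≤ ω.word.length, ℓ j = ℓ' j)
    (hh1 : ∀ j, 1 ≤ j → j ≤ ω.word.length → h1 j = h1' j)
    (hh2 : ∀ j, 1 ≤ j → j ≤ ω.word.length → h2 j = h2' j) : A.RunAt ω ℓ' h1' h2' i := by
  have r1 : ∀ j, ω.M1.rel j i → h1 j = h1' j := fun j hj => by
    have := ω.M1.ordered _ _ hj
    exact hh1 j (by omega) (by omega)
  have r2 : ∀ j, ω.M2.rel j i → h2 j = h2' j := fun j hj => by
    have := ω.M2.ordered _ _ hj
    exact hh2 j (by omega) (by omega)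
  have e1 := hℓ i hi'
  have e2 := hℓ (i - 1) (by omega)
  have e3 := hh1 i hi hi'
  have e4 := hh2 i hi hi'
  unfold RunAt at h ⊢
  grind

theorem runAt_iff_exists {ω : TwoNW α} {ℓ : ℕ → Q} {h1 h2 : ℕ → P} {i : ℕ} :
    A.RunAt ω ℓ h1 h2 i ↔ ∃ (a : α) (q : Q) (g : Q × P × P),
      ω.word[i - 1]? = some a ∧ ℓ (i - 1) = q ∧ (ℓ i, h1 i, h2 i) = g ∧
    ((ω.M1.IsCall i ∧ ω.M2.IsCall i ∧ ((q, a), (g.2.1, g.2.2, g.1)) ∈ A.Δcc)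
   ∨ (∃ p, (∃ j, ω.M1.rel j i ∧ h1 j = p) ∧ ω.M2.IsCall i ∧ ((q, p, a), (g.2.2, g.1)) ∈ A.Δrc)
   ∨ (∃ p, (∃ j, ω.M2.rel j i ∧ h2 j = p) ∧ ω.M1.IsCall i ∧ ((q, p, a), (g.2.1, g.1)) ∈ A.Δcr)
   ∨ (∃ p p', (∃ j, ω.M1.rel j i ∧ h1 j = p) ∧ (∃ j, ω.M2.rel j i ∧ h2 j = p') ∧
      ((q, p, p', a), g.1) ∈ A.Δrr)
   ∨ (ω.M1.IsCall i ∧ ω.M2.IsInt i ∧ ((q, a), (g.2.1, g.1)) ∈ A.Δci)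
   ∨ (ω.M1.IsInt i ∧ ω.M2.IsCall i ∧ ((q, a), (g.2.2, g.1)) ∈ A.Δic)
   ∨ (∃ p, (∃ j, ω.M1.rel j i ∧ h1 j = p) ∧ ω.M2.IsInt i ∧ ((q, p, a), g.1) ∈ A.Δri)
   ∨ (∃ p, (∃ j, ω.M2.rel j i ∧ h2 j = p) ∧ ω.M1.IsInt i ∧ ((q, p, a), g.1) ∈ A.Δir)
   ∨ (ω.M1.IsInt i ∧ ω.M2.IsInt i ∧ ((q, a), g.1) ∈ A.Δii)) := by
  constructor
  · rintro ⟨a, ha, h⟩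
    refine ⟨a, _, _, ha, rfl, rfl, ?_⟩
    refine h.imp ?_ <| Or.imp ?_ <| Or.imp ?_ <| Or.imp ?_ <| Or.imp ?_ <| Or.imp ?_ <|
      Or.imp ?_ <| Or.imp ?_ ?_ <;> grind
  · rintro ⟨a, _, _, ha, rfl, rfl, h⟩
    refine ⟨a, ha, ?_⟩
    refine h.imp ?_ <| Or.imp ?_ <| Or.imp ?_ <| Or.imp ?_ <| Or.imp ?_ <| Or.imp ?_ <|
      Or.imp ?_ <| Or.imp ?_ ?_ <;> grind

/-- The linear states of a run, given its initial state and its labels at positions. -/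
def stateOf (q₀ : Q) (lab : ℕ → Q × P × P) (i : ℕ) : Q := if i = 0 then q₀ else (lab i).1

variable [Finite Q] [Finite P] [Nonempty (Q × P × P)] {N : ℕ}
  (e : Q × P × P ≃ Fin N)

theorem foDefinable_decodeLabel_mem (S : Set (Q × P × P)) {V : Set ℕ} {x : ℕ} (hx : x ∈ V) :
    FODefinable (α := α) V N fun _ ν1 ν2 => decodeLabel e ν2 (ν1 x) ∈ S :=
  (FODefinable.exists_finite fun g =>
    (foDefinable_decodeLabel e g hx).and (.const (g ∈ S))).congr fun _ _ _ _ => by simp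

variable [Finite α]

theorem foDefinable_runAt (q₀ : Q) : FODefinable {0} N fun ω ν1 ν2 =>
    A.RunAt ω (stateOf q₀ (decodeLabel e ν2)) (fun i => (decodeLabel e ν2 i).2.1)
      (fun i => (decodeLabel e ν2 i).2.2) (ν1 0) := by
  have c1 := FODefinable.isCall (N := N) (fun {V x y} => FODefinable.rel1 (α := α))
  have c2 := FODefinable.isCall (N := N) (fun {V x y} => FODefinable.rel2 (α := α))
  have i1 := FODefinable.isInt (N := N) (fun {V x y} => FODefinable.rel1 (α := α))
  have i2 := FODefinable.isInt (N := N) (fun {V x y} => FODefinable.rel2 (α := α))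
  have r1 := fun p => FODefinable.exists_call (fun {V x y} => FODefinable.rel1 (α := α))
    (T := fun ν2 j => decodeLabel e ν2 j ∈ {g | g.2.1 = p})
    (fun {V x} hx => foDefinable_decodeLabel_mem e _ hx)
  have r2 := fun p => FODefinable.exists_call (fun {V x y} => FODefinable.rel2 (α := α))
    (T := fun ν2 j => decodeLabel e ν2 j ∈ {g | g.2.2 = p})
    (fun {V x} hx => foDefinable_decodeLabel_mem e _ hx)
  have hq := fun q => FODefinable.pred (α := α) (q₀ = q)
    (T := fun ν2 j => decodeLabel e ν2 j ∈ {g | g.1 = q})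
    (fun {V x} hx => foDefinable_decodeLabel_mem e _ hx)
  have hg := fun g => foDefinable_decodeLabel (α := α) e g (V := {0}) (x := 0) rfl
  have ha := fun a : α => FODefinable.letter (N := N) (V := {0}) (x := 0) a rfl
  refine FODefinable.congr (.exists_finite fun a => .exists_finite fun q => .exists_finite fun g =>
    (ha a).and <| (hq q).and <| (hg g).and <|
      (c1.and (c2.and (.const (((q, a), (g.2.1, g.2.2, g.1)) ∈ A.Δcc)))).or <|
      (FODefinable.exists_finite fun p =>
        (r1 p).and (c2.and (.const (((q, p, a), (g.2.2, g.1)) ∈ A.Δrc)))).or <|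
      (FODefinable.exists_finite fun p =>
        (r2 p).and (c1.and (.const (((q, p, a), (g.2.1, g.1)) ∈ A.Δcr)))).or <|
      (FODefinable.exists_finite fun p => .exists_finite fun p' =>
        (r1 p).and ((r2 p').and (.const (((q, p, p', a), g.1) ∈ A.Δrr)))).or <|
      (c1.and (i2.and (.const (((q, a), (g.2.1, g.1)) ∈ A.Δci)))).or <|
      (i1.and (c2.and (.const (((q, a), (g.2.2, g.1)) ∈ A.Δic)))).or <|
      (FODefinable.exists_finite fun p =>
        (r1 p).and (i2.and (.const (((q, p, a), g.1) ∈ A.Δri)))).or <|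
      (FODefinable.exists_finite fun p =>
        (r2 p).and (i1.and (.const (((q, p, a), g.1) ∈ A.Δir)))).or <|
      i1.and (i2.and (.const (((q, a), g.1) ∈ A.Δii)))) ?_
  intro ω ν1 ν2 hν
  have := hν 0 rfl
  rw [runAt_iff_exists]
  refine exists_congr fun a => exists_congr fun q => exists_congr fun g =>
    and_congr_right fun _ => and_congr ?_ (and_congr ?_ Iff.rfl)
  · by_cases h : ν1 0 = 1
    · simp [h, stateOf]
    · simp [h, stateOf, show ν1 0 - 1 ≠ 0 by omega]
  · simp [stateOf, show ν1 0 ≠ 0 by omega]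

theorem foDefinable_accepts : FODefinable ∅ N fun ω _ ν2 =>
    ∃ q₀ ∈ A.init, A.IsRun ω (stateOf q₀ (decodeLabel e ν2)) (fun i => (decodeLabel e ν2 i).2.1)
      (fun i => (decodeLabel e ν2 i).2.2) ∧
        stateOf q₀ (decodeLabel e ν2) ω.word.length ∈ A.final := by
  refine FODefinable.congr (.exists_finite fun q₀ => (FODefinable.const (q₀ ∈ A.init)).and <|
    (FODefinable.forall_position (x := 0) ((A.foDefinable_runAt e q₀).mono (by simp))).and <|
    FODefinable.last (q₀ ∈ A.final) (T := fun ν2 j => decodeLabel e ν2 j ∈ {g | g.1 ∈ A.final})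
      (fun {V x} hx => foDefinable_decodeLabel_mem e _ hx)) ?_
  intro ω ν1 ν2 _
  refine exists_congr fun q₀ => and_congr_right fun _ => and_congr ?_ ?_
  · simp [IsRun]
  · by_cases h : ω.word.length = 0
    · simp [h, stateOf]
    · simp [h, stateOf]

end TwoNWA

namespace MSO

variable {α : Type}

/-- The formula `∃X₀ … ∃X_{N-1} φ`. -/
def exsSO : ℕ → MSO α → MSO α
  | 0, φ => φ
  | N + 1, φ => exsSO N (.exSO N φ)

theorem IsEMSO.exsSO {φ : MSO α} (h : φ.IsEMSO) (N : ℕ) : (φ.exsSO N).IsEMSO := by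
  induction N generalizing φ with
  | zero => exact h
  | succ N ih => exact ih h.ex

theorem freeFO_exsSO (φ : MSO α) (N : ℕ) : (φ.exsSO N).freeFO = φ.freeFO := by
  induction N generalizing φ with
  | zero => rfl
  | succ N ih => exact ih _

theorem freeSO_exsSO {φ : MSO α} {N : ℕ} (h : φ.freeSO ⊆ Set.Iio N) :
    (φ.exsSO N).freeSO = ∅ := by
  induction N generalizing φ with
  | zero => exact Set.subset_empty_iff.1 fun x hx => absurd (h hx) (Nat.not_lt_zero x)
  | succ N ih =>
    refine ih fun X hX => ?_
    have h1 : X < N + 1 := h hX.1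
    have h2 : X ≠ N := hX.2
    exact show X < N by omega

theorem exists_of_sat_exsSO {ω : TwoNW α} {φ : MSO α} {N : ℕ} {ν1 : ℕ → ℕ} {ν2 : ℕ → Set ℕ}
    (h : Sat ω ν1 ν2 (φ.exsSO N)) : ∃ ν2', Sat ω ν1 ν2' φ := by
  induction N generalizing φ with
  | zero => exact ⟨ν2, h⟩
  | succ N ih =>
    obtain ⟨ν2', I, -, h⟩ := ih h
    exact ⟨_, h⟩

theorem sat_exsSO {ω : TwoNW α} {φ : MSO α} (N : ℕ) {ν1 : ℕ → ℕ} {ν2 : ℕ → Set ℕ}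
    (hν : ∀ X, ν2 X ⊆ Set.Icc 1 ω.word.length) (h : Sat ω ν1 ν2 φ) :
    Sat ω ν1 ν2 (φ.exsSO N) := by
  induction N generalizing φ with
  | zero => exact h
  | succ N ih => exact ih ⟨ν2 N, hν N, by rwa [Function.update_eq_self]⟩

end MSO

theorem TwoNWA.exists_isEMSO {α Q P : Type} [Finite α] [Finite Q] [Finite P]
    (A : TwoNWA α Q P) :
    ∃ φ : MSO α, φ.Closed ∧ φ.IsEMSO ∧ ∀ ω, MSO.Models ω φ ↔ A.Accepts ω := by
  by_cases hG : Nonempty (Q × P × P)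
  · obtain ⟨N, ⟨e⟩⟩ := Finite.exists_equiv_fin (Q × P × P)
    obtain ⟨ψ, h1, h2, h3, h4⟩ := A.foDefinable_accepts e
    have hc : (ψ.exsSO N).Closed :=
      ⟨(ψ.freeFO_exsSO N).trans (Set.subset_empty_iff.1 h2), MSO.freeSO_exsSO h3⟩
    refine ⟨ψ.exsSO N, hc, (MSO.IsEMSO.fo h1).exsSO N, fun ω => ⟨fun h => ?_, ?_⟩⟩
    · obtain ⟨ν2, h⟩ := MSO.exists_of_sat_exsSO (h (fun _ => 0) fun _ => ∅)
      obtain ⟨q₀, hq, hr, hf⟩ := (h4 ω _ _ (by simp)).1 h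
      exact ⟨_, _, _, hr, by simpa [stateOf] using hq, hf⟩
    · rintro ⟨ℓ, k1, k2, hr, hi, hf⟩
      obtain ⟨ν2, hν, hlab⟩ := exists_decodeLabel_eq e (fun i => (ℓ i, k1 i, k2 i)) ω.word.length
      have hℓ : ∀ j ≤ ω.word.length, ℓ j = stateOf (ℓ 0) (decodeLabel e ν2) j := fun j hj => by
        by_cases h0 : j = 0
        · simp [stateOf, h0]
        · simp [stateOf, h0, hlab j (by omega) hj]
      refine (hc.models_iff ω (fun _ => 0) ν2).2 (MSO.sat_exsSO N hν ((h4 ω _ _ (by simp)).2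
        ⟨ℓ 0, hi, fun i hi hi' => (hr i hi hi').congr hi hi' hℓ (fun j hj hj' => ?_)
          (fun j hj hj' => ?_), (hℓ _ le_rfl) ▸ hf⟩))
      · rw [hlab j hj hj']
      · rw [hlab j hj hj']
  · refine ⟨.exFO 0 (.lt 0 0), ⟨by simp [MSO.freeFO], by simp [MSO.freeSO]⟩, .fo trivial,
      fun ω => iff_of_false (fun h => ?_) ?_⟩
    · obtain ⟨i, -, -, h⟩ := h (fun _ => 0) fun _ => ∅
      exact lt_irrefl _ h
    · rintro ⟨ℓ, h1, h2, -⟩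
      exact hG ⟨(ℓ 0, h1 0, h2 0)⟩

/-- For languages of 2-wave words: EMSO-definable ↔
MSO-definable ↔ regular. -/
theorem emso_mso_regular_equiv (α : Type) [Finite α] (L : Set (TwoNW α))
    (hL : ∀ ω ∈ L, ω.IsWaveWord) :
    ((∃ φ : MSO α, φ.Closed ∧ φ.IsEMSO ∧ L = MSOLangWW φ) ↔
      (∃ φ : MSO α, φ.Closed ∧ L = MSOLangWW φ)) ∧
    ((∃ φ : MSO α, φ.Closed ∧ L = MSOLangWW φ) ↔
      (∃ (Q P : Type) (_ : Finite Q) (_ : Finite P) (A : TwoNWA α Q P),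
        L = A.langWW)) := by
  have hreg : (∃ φ : MSO α, φ.Closed ∧ L = MSOLangWW φ) →
      ∃ (Q P : Type) (_ : Finite Q) (_ : Finite P) (A : TwoNWA α Q P), L = A.langWW := by
    rintro ⟨φ, hφ, rfl⟩
    exact MSO.exists_langWW_eq hφ
  have hemso : (∃ (Q P : Type) (_ : Finite Q) (_ : Finite P) (A : TwoNWA α Q P), L = A.langWW) →
      ∃ φ : MSO α, φ.Closed ∧ φ.IsEMSO ∧ L = MSOLangWW φ := by
    rintro ⟨Q, P, _, _, A, rfl⟩
    obtain ⟨φ, hc, he, hφ⟩ := A.exists_isEMSO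
    exact ⟨φ, hc, he, Set.ext fun ω => and_comm.trans (and_congr_right fun _ => (hφ ω).symm)⟩
  have hmso : (∃ φ : MSO α, φ.Closed ∧ φ.IsEMSO ∧ L = MSOLangWW φ) →
      ∃ φ : MSO α, φ.Closed ∧ L = MSOLangWW φ := fun ⟨φ, hc, _, h⟩ => ⟨φ, hc, h⟩
  exact ⟨⟨hmso, fun h => hemso (hreg h)⟩, ⟨hreg, fun h => hmso (hemso h)⟩⟩
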